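/- arXiv:2502.01539 — 3 statements merged into one kernel-verified Lean document; each statement's English description precedes it below -/
import Mathlib

section
/- The ideal of the variety of flexes F of plane cubics, i.e. the ideal of the polynomial algebra P = k[x_0,x_1,x_2, α_{i_0 i_1 i_2} (i_0+i_1+i_2=3)] generated by all bi-homogeneous elements vanishing on F ⊂ P(L)×P(Φ), is a prime ideal and is generated by the two polynomials f and h. -/
/-!
Setting: `k` algebraically closed of characteristic zero, `L = k³` with coordinates
`x₀,x₁,x₂`, `Φ = S³(L*)` the 10-dimensional space of ternary cubics with coordinates
`α_{i₀i₁i₂}` (enumerated by `Fin 10` via the exponent vectors `cubicExp`).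
`P = k[x₀,x₁,x₂, α_{i₀i₁i₂}]` is `MvPolynomial (Fin 3 ⊕ Fin 10) k`;
points of `L × Φ` are `Sum.elim v w` for `v : Fin 3 → k`, `w : Fin 10 → k`.
-/

noncomputable section

open MvPolynomial

/-- The ten exponent vectors `(i₀,i₁,i₂)` with `i₀+i₁+i₂ = 3`. -/
def cubicExp : Fin 10 → Fin 3 → ℕ :=
  ![![3,0,0], ![0,3,0], ![0,0,3], ![2,1,0], ![2,0,1],
    ![1,2,0], ![0,2,1], ![1,0,2], ![0,1,2], ![1,1,1]]

variable (k : Type) [Field k]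

/-- `f = Σ_{i₀+i₁+i₂=3} α_{i₀i₁i₂} x₀^{i₀} x₁^{i₁} x₂^{i₂}`, the generic ternary cubic. -/
def fpoly : MvPolynomial (Fin 3 ⊕ Fin 10) k :=
  ∑ j : Fin 10, X (Sum.inr j) * ∏ i : Fin 3, X (Sum.inl i) ^ cubicExp j i

/-- `h = det(∂²f/∂xᵢ∂xⱼ)`, the Hessian determinant of `f` in the `x`-variables. -/
def hpoly : MvPolynomial (Fin 3 ⊕ Fin 10) k :=
  Matrix.det (Matrix.of fun i j : Fin 3 =>
    pderiv (Sum.inl i) (pderiv (Sum.inl j) (fpoly k)))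

/-- The variety of flexes `F ⊆ ℙ(L) × ℙ(Φ)`: the pairs of points at which both `f`
and `h` vanish (vanishing being tested on representatives). -/
def Flex : Set (Projectivization k (Fin 3 → k) × Projectivization k (Fin 10 → k)) :=
  {PQ | ∀ (v : Fin 3 → k) (w : Fin 10 → k) (hv : v ≠ 0) (hw : w ≠ 0),
    Projectivization.mk k v hv = PQ.1 → Projectivization.mk k w hw = PQ.2 →
    eval (Sum.elim v w) (fpoly k) = 0 ∧ eval (Sum.elim v w) (hpoly k) = 0}

/-- Bi-homogeneity of an element of `P` (of some bi-degree `(d, e)`) with respect to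
the two groups of variables `{xᵢ}` and `{α}`. -/
def IsBiHomogeneous (g : MvPolynomial (Fin 3 ⊕ Fin 10) k) : Prop :=
  ∃ d e : ℕ, ∀ (a b : k) (v : Fin 3 → k) (w : Fin 10 → k), a ≠ 0 → b ≠ 0 →
    eval (Sum.elim (a • v) (b • w)) g = a ^ d * b ^ e * eval (Sum.elim v w) g

/-- A polynomial `g ∈ P` vanishes on a subset `S ⊆ ℙ(L) × ℙ(Φ)` if it vanishes at all
representatives of all points of `S`. -/
def VanishesOn (g : MvPolynomial (Fin 3 ⊕ Fin 10) k)
    (S : Set (Projectivization k (Fin 3 → k) × Projectivization k (Fin 10 → k))) : Prop :=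
  ∀ PQ ∈ S, ∀ (v : Fin 3 → k) (w : Fin 10 → k) (hv : v ≠ 0) (hw : w ≠ 0),
    Projectivization.mk k v hv = PQ.1 → Projectivization.mk k w hw = PQ.2 →
    eval (Sum.elim v w) g = 0

/-- The ideal of `F`: the ideal of `P` generated by all bi-homogeneous elements
vanishing on `F`. -/
def flexIdeal : Ideal (MvPolynomial (Fin 3 ⊕ Fin 10) k) :=
  Ideal.span {g | IsBiHomogeneous k g ∧ VanishesOn k g (Flex k)}

section TernaryCubic

variable {R S : Type*} [CommRing R] [CommRing S] (x : Fin 3 → R) (a : Fin 10 → R)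

/-- The value at `x` of the ternary cubic with coefficients `a`. -/
def cubic : R :=
  a 0 * x 0 ^ 3 + a 1 * x 1 ^ 3 + a 2 * x 2 ^ 3 + a 3 * x 0 ^ 2 * x 1 + a 4 * x 0 ^ 2 * x 2 +
    a 5 * x 0 * x 1 ^ 2 + a 6 * x 1 ^ 2 * x 2 + a 7 * x 0 * x 2 ^ 2 + a 8 * x 1 * x 2 ^ 2 +
    a 9 * x 0 * x 1 * x 2

/-- The partial derivative `∂/∂x₁` of the cubic. -/
def cubicD1 : R :=
  3 * a 1 * x 1 ^ 2 + a 3 * x 0 ^ 2 + 2 * a 5 * x 0 * x 1 + 2 * a 6 * x 1 * x 2 +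
    a 8 * x 2 ^ 2 + a 9 * x 0 * x 2

/-- The partial derivative `∂/∂x₂` of the cubic. -/
def cubicD2 : R :=
  3 * a 2 * x 2 ^ 2 + a 4 * x 0 ^ 2 + a 6 * x 1 ^ 2 + 2 * a 7 * x 0 * x 2 +
    2 * a 8 * x 1 * x 2 + a 9 * x 0 * x 1

/-- The second partial derivative `∂²/∂x₀²` of the cubic. -/
def cubicD00 : R := 6 * a 0 * x 0 + 2 * a 3 * x 1 + 2 * a 4 * x 2

/-- The second partial derivative `∂²/∂x₀∂x₁` of the cubic. -/
def cubicD01 : R := 2 * a 3 * x 0 + 2 * a 5 * x 1 + a 9 * x 2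

/-- The second partial derivative `∂²/∂x₀∂x₂` of the cubic. -/
def cubicD02 : R := 2 * a 4 * x 0 + 2 * a 7 * x 2 + a 9 * x 1

/-- The second partial derivative `∂²/∂x₁²` of the cubic. -/
def cubicD11 : R := 6 * a 1 * x 1 + 2 * a 5 * x 0 + 2 * a 6 * x 2

/-- The second partial derivative `∂²/∂x₁∂x₂` of the cubic. -/
def cubicD12 : R := 2 * a 6 * x 1 + 2 * a 8 * x 2 + a 9 * x 0

/-- The second partial derivative `∂²/∂x₂²` of the cubic. -/
def cubicD22 : R := 6 * a 2 * x 2 + 2 * a 7 * x 0 + 2 * a 8 * x 1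

/-- The Hessian determinant of the cubic. -/
def hessian : R :=
  cubicD00 x a * (cubicD11 x a * cubicD22 x a - cubicD12 x a ^ 2) -
    cubicD01 x a * (cubicD01 x a * cubicD22 x a - cubicD12 x a * cubicD02 x a) +
    cubicD02 x a * (cubicD01 x a * cubicD12 x a - cubicD11 x a * cubicD02 x a)

/-- A cubic form in the coefficients which, after the substitution `taylorCoeff`, agrees modulo `f`
with the Hessian determinant up to a constant and a power of `x₀`, see `sq_mul_hessian`. -/
def flexForm (a : Fin 10 → R) : R := a 3 ^ 2 * a 7 + (a 4 ^ 2 * a 5 - 2 * a 3 * a 4 * a 9)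

/-- The coefficients after the substitution replacing the coefficients divisible by `x₀` by
the corresponding partial derivatives. -/
def taylorCoeff : Fin 10 → R :=
  ![cubic x a, a 1, a 2, cubicD1 x a, cubicD2 x a, cubicD11 x a, a 6, cubicD22 x a, a 8,
    cubicD12 x a]

theorem sq_mul_hessian :
    x 0 ^ 2 * hessian x a =
      6 * (cubicD11 x a * cubicD22 x a - cubicD12 x a ^ 2) * cubic x a -
        4 * flexForm (taylorCoeff x a) := by
  have e0 : x 0 ^ 2 * cubicD00 x a = 6 * cubic x a - 4 * x 1 * cubicD1 x a -
      4 * x 2 * cubicD2 x a + x 1 ^ 2 * cubicD11 x a + 2 * x 1 * x 2 * cubicD12 x a +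
      x 2 ^ 2 * cubicD22 x a := by
    simp only [cubicD00, cubic, cubicD1, cubicD2, cubicD11, cubicD12, cubicD22]; ring
  have e1 : x 0 * cubicD01 x a = 2 * cubicD1 x a - x 1 * cubicD11 x a - x 2 * cubicD12 x a := by
    simp only [cubicD01, cubicD1, cubicD11, cubicD12]; ring
  have e2 : x 0 * cubicD02 x a = 2 * cubicD2 x a - x 1 * cubicD12 x a - x 2 * cubicD22 x a := by
    simp only [cubicD02, cubicD2, cubicD22, cubicD12]; ring
  have hq : flexForm (taylorCoeff x a) = cubicD1 x a ^ 2 * cubicD22 x a +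
      (cubicD2 x a ^ 2 * cubicD11 x a - 2 * cubicD1 x a * cubicD2 x a * cubicD12 x a) := rfl
  have hh : x 0 ^ 2 * hessian x a =
      (x 0 ^ 2 * cubicD00 x a) * (cubicD11 x a * cubicD22 x a - cubicD12 x a ^ 2) -
      (x 0 * cubicD01 x a) * ((x 0 * cubicD01 x a) * cubicD22 x a -
        cubicD12 x a * (x 0 * cubicD02 x a)) +
      (x 0 * cubicD02 x a) * ((x 0 * cubicD01 x a) * cubicD12 x a -
        cubicD11 x a * (x 0 * cubicD02 x a)) := by
    simp only [hessian]; ring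
  rw [hh, e0, e1, e2, hq]
  ring

variable {x a}

theorem map_cubic {F : Type*} [FunLike F R S] [RingHomClass F R S] (φ : F) :
    φ (cubic x a) = cubic (fun i => φ (x i)) (fun j => φ (a j)) := by
  simp [cubic]

theorem map_hessian {F : Type*} [FunLike F R S] [RingHomClass F R S] (φ : F) :
    φ (hessian x a) = hessian (fun i => φ (x i)) (fun j => φ (a j)) := by
  simp [hessian, cubicD00, cubicD01, cubicD02, cubicD11, cubicD12, cubicD22, map_ofNat]

theorem map_flexForm {F : Type*} [FunLike F R S] [RingHomClass F R S] (φ : F) :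
    φ (flexForm a) = flexForm (fun j => φ (a j)) := by
  simp [flexForm, map_ofNat]

theorem map_taylorCoeff {F : Type*} [FunLike F R S] [RingHomClass F R S] (φ : F) (j : Fin 10) :
    φ (taylorCoeff x a j) = taylorCoeff (fun i => φ (x i)) (fun j => φ (a j)) j := by
  fin_cases j <;>
    simp [taylorCoeff, cubic, cubicD1, cubicD2, cubicD11, cubicD12, cubicD22, map_ofNat]

end TernaryCubic

/-- The coordinates `xᵢ` as elements of `P`. -/
abbrev xVar (i : Fin 3) : MvPolynomial (Fin 3 ⊕ Fin 10) k := X (Sum.inl i)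

/-- The coordinates `α` as elements of `P`. -/
abbrev aVar (j : Fin 10) : MvPolynomial (Fin 3 ⊕ Fin 10) k := X (Sum.inr j)

theorem fpoly_eq : fpoly k = cubic (xVar k) (aVar k) := by
  simp [fpoly, cubic, Fin.sum_univ_succ, Fin.prod_univ_succ, cubicExp]
  ring

theorem hpoly_eq : hpoly k = hessian (xVar k) (aVar k) := by
  have pderiv_ofNat (i : Fin 3 ⊕ Fin 10) (n : ℕ) [n.AtLeastTwo] :
      pderiv i (OfNat.ofNat n : MvPolynomial (Fin 3 ⊕ Fin 10) k) = 0 :=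
    (pderiv i).map_natCast n
  have key : (Matrix.of fun i j : Fin 3 =>
      pderiv (Sum.inl i) (pderiv (Sum.inl j) (fpoly k))) =
      !![cubicD00 (xVar k) (aVar k), cubicD01 (xVar k) (aVar k), cubicD02 (xVar k) (aVar k);
        cubicD01 (xVar k) (aVar k), cubicD11 (xVar k) (aVar k), cubicD12 (xVar k) (aVar k);
        cubicD02 (xVar k) (aVar k), cubicD12 (xVar k) (aVar k), cubicD22 (xVar k) (aVar k)] := by
    ext1 i j
    rw [fpoly_eq]
    fin_cases i <;> fin_cases j <;>
    · simp [cubic, cubicD00, cubicD01, cubicD02, cubicD11, cubicD12, cubicD22, pderiv_X,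
        pderiv_ofNat, Pi.single_apply]
      try ring
  rw [hpoly, key, Matrix.det_fin_three]
  simp [hessian]
  ring

variable {k}

theorem map_fpoly {A F : Type*} [CommRing A] [FunLike F (MvPolynomial (Fin 3 ⊕ Fin 10) k) A]
    [RingHomClass F (MvPolynomial (Fin 3 ⊕ Fin 10) k) A] (φ : F) :
    φ (fpoly k) = cubic (fun i => φ (xVar k i)) (fun j => φ (aVar k j)) := by
  rw [fpoly_eq, map_cubic]

theorem map_hpoly {A F : Type*} [CommRing A] [FunLike F (MvPolynomial (Fin 3 ⊕ Fin 10) k) A]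
    [RingHomClass F (MvPolynomial (Fin 3 ⊕ Fin 10) k) A] (φ : F) :
    φ (hpoly k) = hessian (fun i => φ (xVar k i)) (fun j => φ (aVar k j)) := by
  rw [hpoly_eq, map_hessian]

theorem eval_fpoly (v : Fin 3 → k) (w : Fin 10 → k) :
    eval (Sum.elim v w) (fpoly k) = cubic v w := by
  simp [map_fpoly]

theorem eval_hpoly (v : Fin 3 → k) (w : Fin 10 → k) :
    eval (Sum.elim v w) (hpoly k) = hessian v w := by
  simp [map_hpoly]

theorem isBiHomogeneous_fpoly : IsBiHomogeneous k (fpoly k) := by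
  refine ⟨3, 1, fun a b v w _ _ => ?_⟩
  simp only [eval_fpoly, cubic, Pi.smul_apply, smul_eq_mul]
  ring

theorem isBiHomogeneous_hpoly : IsBiHomogeneous k (hpoly k) := by
  refine ⟨3, 3, fun a b v w _ _ => ?_⟩
  simp only [eval_hpoly, hessian, cubicD00, cubicD01, cubicD02, cubicD11, cubicD12, cubicD22,
    Pi.smul_apply, smul_eq_mul]
  ring

theorem not_X_dvd_of_eval_ne_zero {σ : Type*} {i : σ} {p : MvPolynomial σ k} (v : σ → k)
    (hv : v i = 0) (hp : eval v p ≠ 0) : ¬ X i ∣ p := by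
  rintro ⟨q, rfl⟩
  simp [hv] at hp

/-- A polynomial `a * X i + b` with `a` a power of a variable not dividing `b`, and `a`, `b` free
of `X i`, is prime. -/
theorem prime_X_pow_mul_X_add {σ : Type*} {i j : σ} (hij : j ≠ i) (n : ℕ) {b : MvPolynomial σ k}
    (hb : b ∈ supported k ({i}ᶜ : Set σ)) (hdvd : ¬ X j ∣ b) : Prime (X j ^ n * X i + b) := by
  have hvars : ∀ p ∈ supported k ({i}ᶜ : Set σ), i ∉ p.vars := fun p hp hi =>
    mem_supported.1 hp hi rfl
  refine (irreducible_mul_X_add _ _ i (pow_ne_zero _ (X_ne_zero j))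
    (hvars _ (pow_mem (X_mem_supported.2 hij) n)) (hvars _ hb) ?_).prime
  exact ((X_prime.irreducible.isRelPrime_iff_not_dvd).2 hdvd).pow_left

theorem prime_flexForm : Prime (flexForm (aVar k)) := by
  refine prime_X_pow_mul_X_add (i := Sum.inr 7) (j := Sum.inr 3) (by simp) 2 ?_
    (not_X_dvd_of_eval_ne_zero (Sum.elim 0 ![0, 0, 0, 0, 1, 1, 0, 0, 0, 0]) rfl (by simp))
  have h : ∀ j : Fin 10, j ≠ 7 → aVar k j ∈ supported k ({Sum.inr 7}ᶜ : Set (Fin 3 ⊕ Fin 10)) :=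
    fun j hj => X_mem_supported.2 (by simpa using hj)
  exact sub_mem (mul_mem (pow_mem (h 4 (by decide)) 2) (h 5 (by decide)))
    (mul_mem (mul_mem (mul_mem (ofNat_mem _ 2) (h 3 (by decide))) (h 4 (by decide)))
      (h 9 (by decide)))

variable (k) in
/-- The substitution `x₀ ↦ 0`. -/
def restrictLine : MvPolynomial (Fin 3 ⊕ Fin 10) k →ₐ[k] MvPolynomial (Fin 3 ⊕ Fin 10) k :=
  aeval (Sum.elim ![0, xVar k 1, xVar k 2] (aVar k))

variable (k) in
/-- The substitution `α₀ ↦ 0`. -/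
def killCoeff : MvPolynomial (Fin 3 ⊕ Fin 10) k →ₐ[k] MvPolynomial (Fin 3 ⊕ Fin 10) k :=
  aeval (Sum.elim (xVar k) (fun j => if j = 0 then 0 else aVar k j))

theorem X_dvd_sub_aeval {σ : Type*} {i : σ} {g : σ → MvPolynomial σ k}
    (hg : ∀ j, X i ∣ X j - g j) (p : MvPolynomial σ k) : X i ∣ p - aeval g p := by
  induction p using MvPolynomial.induction_on with
  | C a => simp [algebraMap_eq]
  | add p q hp hq =>
    rw [map_add, add_sub_add_comm]
    exact dvd_add hp hq
  | mul_X p j hp =>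
    rw [map_mul, aeval_X, show p * X j - aeval g p * g j =
      (p - aeval g p) * X j + aeval g p * (X j - g j) by ring]
    exact dvd_add (hp.mul_right _) ((hg j).mul_left _)

theorem X_dvd_sub_restrictLine (p : MvPolynomial (Fin 3 ⊕ Fin 10) k) :
    xVar k 0 ∣ p - restrictLine k p := by
  refine X_dvd_sub_aeval ?_ p
  rintro (j | j)
  · fin_cases j <;> simp
  · simp

theorem X_dvd_sub_killCoeff (p : MvPolynomial (Fin 3 ⊕ Fin 10) k) :
    aVar k 0 ∣ p - killCoeff k p := by
  refine X_dvd_sub_aeval ?_ p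
  rintro (j | j)
  · simp
  · by_cases h : j = 0 <;> simp [h]

theorem killCoeff_flexForm : killCoeff k (flexForm (aVar k)) = flexForm (aVar k) := by
  simp [killCoeff, map_flexForm]
  simp [flexForm]

variable (k) in
theorem mem_span_flexForm_iff (p : MvPolynomial (Fin 3 ⊕ Fin 10) k) :
    p ∈ Ideal.span {aVar k 0, flexForm (aVar k)} ↔
      p ∈ (Ideal.span {flexForm (aVar k)}).comap (killCoeff k) := by
  rw [Ideal.mem_comap, Ideal.mem_span_pair, Ideal.mem_span_singleton]
  constructor
  · rintro ⟨u, v, rfl⟩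
    refine ⟨killCoeff k v, ?_⟩
    rw [map_add, map_mul, map_mul, killCoeff_flexForm]
    simp [killCoeff, mul_comm]
  · rintro ⟨v, hv⟩
    obtain ⟨u, hu⟩ := X_dvd_sub_killCoeff p
    exact ⟨u, v, by linear_combination -hu - hv⟩

theorem isPrime_span_flexForm : (Ideal.span {aVar k 0, flexForm (aVar k)}).IsPrime := by
  have : (Ideal.span {flexForm (aVar k)}).IsPrime :=
    (Ideal.span_singleton_prime prime_flexForm.ne_zero).2 prime_flexForm
  rw [show Ideal.span {aVar k 0, flexForm (aVar k)} = _ from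
    Ideal.ext (mem_span_flexForm_iff k)]
  exact Ideal.IsPrime.comap _

theorem xVar_pow_notMem_span_flexForm (n : ℕ) :
    xVar k 0 ^ n ∉ Ideal.span {aVar k 0, flexForm (aVar k)} := by
  rw [Ideal.mem_span_pair]
  rintro ⟨u, v, h⟩
  simpa [map_flexForm, flexForm] using congrArg (eval (Sum.elim 1 0)) h

variable (k) in
/-- The substitution `α ↦ taylorCoeff x α`. -/
def taylorHom : MvPolynomial (Fin 3 ⊕ Fin 10) k →ₐ[k] MvPolynomial (Fin 3 ⊕ Fin 10) k :=
  aeval (Sum.elim (xVar k) (taylorCoeff (xVar k) (aVar k)))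

@[simp]
theorem taylorHom_xVar (i : Fin 3) : taylorHom k (X (Sum.inl i)) = xVar k i := by
  simp [taylorHom]

@[simp]
theorem taylorHom_aVar (j : Fin 10) :
    taylorHom k (X (Sum.inr j)) = taylorCoeff (xVar k) (aVar k) j := by
  simp [taylorHom]

theorem taylorHom_aVar_zero : taylorHom k (aVar k 0) = fpoly k := by
  rw [taylorHom_aVar, fpoly_eq]
  rfl

theorem xVar_sq_mul_hpoly : ∃ c, xVar k 0 ^ 2 * hpoly k =
    c * fpoly k - 4 * taylorHom k (flexForm (aVar k)) :=
  ⟨_, by simpa [fpoly_eq, hpoly_eq, map_flexForm] using sq_mul_hessian (xVar k) (aVar k)⟩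

/-- Over a field, the substitution `taylorCoeff` is onto wherever `x₀ ≠ 0`. -/
theorem exists_taylorCoeff_eq [CharZero k] (v : Fin 3 → k) (hv : v 0 ≠ 0) (w : Fin 10 → k) :
    ∃ u, taylorCoeff v u = w := by
  obtain ⟨u5, h5⟩ : ∃ t, 6 * w 1 * v 1 + 2 * t * v 0 + 2 * w 6 * v 2 = w 5 :=
    ⟨(w 5 - 6 * w 1 * v 1 - 2 * w 6 * v 2) / (2 * v 0), by field_simp; ring⟩
  obtain ⟨u7, h7⟩ : ∃ t, 6 * w 2 * v 2 + 2 * t * v 0 + 2 * w 8 * v 1 = w 7 :=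
    ⟨(w 7 - 6 * w 2 * v 2 - 2 * w 8 * v 1) / (2 * v 0), by field_simp; ring⟩
  obtain ⟨u9, h9⟩ : ∃ t, 2 * w 6 * v 1 + 2 * w 8 * v 2 + t * v 0 = w 9 :=
    ⟨(w 9 - 2 * w 6 * v 1 - 2 * w 8 * v 2) / v 0, by field_simp; ring⟩
  obtain ⟨u3, h3⟩ : ∃ t, 3 * w 1 * v 1 ^ 2 + t * v 0 ^ 2 + 2 * u5 * v 0 * v 1 +
      2 * w 6 * v 1 * v 2 + w 8 * v 2 ^ 2 + u9 * v 0 * v 2 = w 3 :=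
    ⟨(w 3 - 3 * w 1 * v 1 ^ 2 - 2 * u5 * v 0 * v 1 - 2 * w 6 * v 1 * v 2 - w 8 * v 2 ^ 2 -
      u9 * v 0 * v 2) / v 0 ^ 2, by field_simp; ring⟩
  obtain ⟨u4, h4⟩ : ∃ t, 3 * w 2 * v 2 ^ 2 + t * v 0 ^ 2 + w 6 * v 1 ^ 2 + 2 * u7 * v 0 * v 2 +
      2 * w 8 * v 1 * v 2 + u9 * v 0 * v 1 = w 4 :=
    ⟨(w 4 - 3 * w 2 * v 2 ^ 2 - w 6 * v 1 ^ 2 - 2 * u7 * v 0 * v 2 - 2 * w 8 * v 1 * v 2 -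
      u9 * v 0 * v 1) / v 0 ^ 2, by field_simp; ring⟩
  obtain ⟨u0, h0⟩ : ∃ t, t * v 0 ^ 3 + cubic v ![0, w 1, w 2, u3, u4, u5, w 6, u7, w 8, u9] =
      w 0 :=
    ⟨(w 0 - cubic v ![0, w 1, w 2, u3, u4, u5, w 6, u7, w 8, u9]) / v 0 ^ 3, by
      field_simp; ring⟩
  refine ⟨![u0, w 1, w 2, u3, u4, u5, w 6, u7, w 8, u9], funext fun j => ?_⟩
  fin_cases j
  · refine Eq.trans ?_ h0
    simp [taylorCoeff, cubic]
    ring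
  · rfl
  · rfl
  · exact h3
  · exact h4
  · exact h5
  · rfl
  · exact h7
  · rfl
  · exact h9

theorem taylorHom_injective [CharZero k] : Function.Injective (taylorHom k) := by
  rw [injective_iff_map_eq_zero]
  intro c hc
  refine (mul_eq_zero.1 (?_ : xVar k 0 * c = 0)).resolve_left (X_ne_zero _)
  refine MvPolynomial.funext fun pt => ?_
  by_cases h0 : pt (Sum.inl 0) = 0
  · simp [h0]
  obtain ⟨u, hu⟩ := exists_taylorCoeff_eq (pt ∘ Sum.inl) h0 (pt ∘ Sum.inr)
  have hcomp : (eval (Sum.elim (pt ∘ Sum.inl) u)).comp (taylorHom k : _ →+* _) = eval pt := by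
    refine MvPolynomial.ringHom_ext (by simp) ?_
    rintro (i | j)
    · simp
    · simpa [map_taylorCoeff, Function.comp_def] using congrFun hu j
  have := RingHom.congr_fun hcomp c
  simp [hc] at this
  simp [← this]

/-- Up to powers of `x₀` the substitution `taylorHom` is surjective. -/
theorem exists_xVar_pow_mul_eq_taylorHom [CharZero k] (p : MvPolynomial (Fin 3 ⊕ Fin 10) k) :
    ∃ n c, xVar k 0 ^ n * p = taylorHom k c := by
  let A : Subalgebra k (MvPolynomial (Fin 3 ⊕ Fin 10) k) :=
    { carrier := {p | ∃ n c, xVar k 0 ^ n * p = taylorHom k c}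
      mul_mem' := by
        rintro p q ⟨n, c, hc⟩ ⟨m, d, hd⟩
        exact ⟨n + m, c * d, by rw [map_mul, ← hc, ← hd]; ring⟩
      add_mem' := by
        rintro p q ⟨n, c, hc⟩ ⟨m, d, hd⟩
        refine ⟨n + m, xVar k 0 ^ m * c + xVar k 0 ^ n * d, ?_⟩
        rw [map_add, map_mul, map_mul, map_pow, map_pow, taylorHom_xVar, ← hc, ← hd]
        ring
      algebraMap_mem' := fun r => ⟨0, C r, by simp [algebraMap_eq, algHom_C]⟩ }
  have cancel (n : ℕ) {q} (hq : 2 * (xVar k 0 ^ n * q) ∈ A) : q ∈ A := by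
    have h2 : xVar k 0 ^ n * q ∈ A := by
      have := A.smul_mem hq (2⁻¹ : k)
      rwa [two_mul, ← two_smul k (_ * q), smul_smul, inv_mul_cancel₀ two_ne_zero,
        one_smul] at this
    obtain ⟨m, c, hc⟩ := h2
    exact ⟨m + n, c, by rw [← hc]; ring⟩
  have hx (i : Fin 3) : xVar k i ∈ A := ⟨0, xVar k i, by simp⟩
  have ht (j : Fin 10) : taylorCoeff (xVar k) (aVar k) j ∈ A := ⟨0, aVar k j, by simp⟩
  have hA (q) (hq : q ∈ A) : ∃ n c, xVar k 0 ^ n * q = taylorHom k c := hq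
  clear_value A
  have h1 : aVar k 1 ∈ A := ht 1
  have h2 : aVar k 2 ∈ A := ht 2
  have h6 : aVar k 6 ∈ A := ht 6
  have h8 : aVar k 8 ∈ A := ht 8
  have h5 : aVar k 5 ∈ A := by
    refine cancel 1 ?_
    rw [show 2 * (xVar k 0 ^ 1 * aVar k 5) = taylorCoeff (xVar k) (aVar k) 5 -
      (6 * aVar k 1 * xVar k 1 + 2 * aVar k 6 * xVar k 2) by
        simp [taylorCoeff, cubicD11]; ring]
    refine sub_mem (ht 5) ?_
    repeat' with_reducible first
      | assumption | exact hx _ | exact pow_mem (hx _) _ | exact ofNat_mem _ _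
      | apply add_mem | apply mul_mem
  have h7 : aVar k 7 ∈ A := by
    refine cancel 1 ?_
    rw [show 2 * (xVar k 0 ^ 1 * aVar k 7) = taylorCoeff (xVar k) (aVar k) 7 -
      (6 * aVar k 2 * xVar k 2 + 2 * aVar k 8 * xVar k 1) by
        simp [taylorCoeff, cubicD22]; ring]
    refine sub_mem (ht 7) ?_
    repeat' with_reducible first
      | assumption | exact hx _ | exact pow_mem (hx _) _ | exact ofNat_mem _ _
      | apply add_mem | apply mul_mem
  have h9 : aVar k 9 ∈ A := by
    refine cancel 1 ?_
    rw [show 2 * (xVar k 0 ^ 1 * aVar k 9) = 2 * (taylorCoeff (xVar k) (aVar k) 9 -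
      (2 * aVar k 6 * xVar k 1 + 2 * aVar k 8 * xVar k 2)) by
        simp [taylorCoeff, cubicD12]; ring]
    refine mul_mem (ofNat_mem _ 2) (sub_mem (ht 9) ?_)
    repeat' with_reducible first
      | assumption | exact hx _ | exact pow_mem (hx _) _ | exact ofNat_mem _ _
      | apply add_mem | apply mul_mem
  have h3 : aVar k 3 ∈ A := by
    refine cancel 2 ?_
    rw [show 2 * (xVar k 0 ^ 2 * aVar k 3) = 2 * (taylorCoeff (xVar k) (aVar k) 3 -
      (3 * aVar k 1 * xVar k 1 ^ 2 + 2 * aVar k 5 * xVar k 0 * xVar k 1 +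
        2 * aVar k 6 * xVar k 1 * xVar k 2 + aVar k 8 * xVar k 2 ^ 2 +
        aVar k 9 * xVar k 0 * xVar k 2)) by
        simp [taylorCoeff, cubicD1]; ring]
    refine mul_mem (ofNat_mem _ 2) (sub_mem (ht 3) ?_)
    repeat' with_reducible first
      | assumption | exact hx _ | exact pow_mem (hx _) _ | exact ofNat_mem _ _
      | apply add_mem | apply mul_mem
  have h4 : aVar k 4 ∈ A := by
    refine cancel 2 ?_
    rw [show 2 * (xVar k 0 ^ 2 * aVar k 4) = 2 * (taylorCoeff (xVar k) (aVar k) 4 -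
      (3 * aVar k 2 * xVar k 2 ^ 2 + aVar k 6 * xVar k 1 ^ 2 +
        2 * aVar k 7 * xVar k 0 * xVar k 2 + 2 * aVar k 8 * xVar k 1 * xVar k 2 +
        aVar k 9 * xVar k 0 * xVar k 1)) by
        simp [taylorCoeff, cubicD2]; ring]
    refine mul_mem (ofNat_mem _ 2) (sub_mem (ht 4) ?_)
    repeat' with_reducible first
      | assumption | exact hx _ | exact pow_mem (hx _) _ | exact ofNat_mem _ _
      | apply add_mem | apply mul_mem
  have h0 : aVar k 0 ∈ A := by
    refine cancel 3 ?_
    rw [show 2 * (xVar k 0 ^ 3 * aVar k 0) = 2 * (taylorCoeff (xVar k) (aVar k) 0 -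
      (aVar k 1 * xVar k 1 ^ 3 + aVar k 2 * xVar k 2 ^ 3 + aVar k 3 * xVar k 0 ^ 2 * xVar k 1 +
        aVar k 4 * xVar k 0 ^ 2 * xVar k 2 + aVar k 5 * xVar k 0 * xVar k 1 ^ 2 +
        aVar k 6 * xVar k 1 ^ 2 * xVar k 2 + aVar k 7 * xVar k 0 * xVar k 2 ^ 2 +
        aVar k 8 * xVar k 1 * xVar k 2 ^ 2 + aVar k 9 * xVar k 0 * xVar k 1 * xVar k 2)) by
        simp [taylorCoeff, cubic]; ring]
    refine mul_mem (ofNat_mem _ 2) (sub_mem (ht 0) ?_)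
    repeat' with_reducible first
      | assumption | exact hx _ | exact pow_mem (hx _) _ | exact ofNat_mem _ _
      | apply add_mem | apply mul_mem
  have htop : (⊤ : Subalgebra k (MvPolynomial (Fin 3 ⊕ Fin 10) k)) ≤ A := by
    rw [← adjoin_range_X, Algebra.adjoin_le_iff]
    rintro _ ⟨i | j, rfl⟩
    · exact hx i
    · fin_cases j
      exacts [h0, h1, h2, h3, h4, h5, h6, h7, h8, h9]
  exact hA p (htop Algebra.mem_top)

theorem restrictLine_fpoly : restrictLine k (fpoly k) = xVar k 1 ^ 3 * aVar k 1 +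
    (aVar k 2 * xVar k 2 ^ 3 + aVar k 6 * (xVar k 1 ^ 2 * xVar k 2) +
      aVar k 8 * (xVar k 1 * xVar k 2 ^ 2)) := by
  simp [restrictLine, map_fpoly, cubic]
  ring

theorem prime_restrictLine_fpoly : Prime (restrictLine k (fpoly k)) := by
  rw [restrictLine_fpoly]
  refine prime_X_pow_mul_X_add (by simp) 3 ?_
    (not_X_dvd_of_eval_ne_zero (Sum.elim ![0, 0, 1] 1) rfl (by simp))
  have ha (j : Fin 10) (hj : j ≠ 1) :
      aVar k j ∈ supported k ({Sum.inr 1}ᶜ : Set (Fin 3 ⊕ Fin 10)) :=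
    X_mem_supported.2 (by simpa using hj)
  have hx (i : Fin 3) : xVar k i ∈ supported k ({Sum.inr 1}ᶜ : Set (Fin 3 ⊕ Fin 10)) :=
    X_mem_supported.2 (by simp)
  exact add_mem (add_mem (mul_mem (ha 2 (by decide)) (pow_mem (hx 2) 3))
    (mul_mem (ha 6 (by decide)) (mul_mem (pow_mem (hx 1) 2) (hx 2))))
    (mul_mem (ha 8 (by decide)) (mul_mem (hx 1) (pow_mem (hx 2) 2)))

theorem not_restrictLine_fpoly_dvd [CharZero k] :
    ¬ restrictLine k (fpoly k) ∣ restrictLine k (hpoly k) := by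
  rintro ⟨c, hc⟩
  simpa [restrictLine, map_fpoly, map_hpoly, cubic, hessian, cubicD00, cubicD01, cubicD02,
    cubicD11, cubicD12, cubicD22] using
    congrArg (eval (Sum.elim ![0, 1, 0] ![0, 0, 0, 0, 0, 1, 0, 0, 1, 0])) hc

/-- The variable `x₀` is regular modulo `(f, h)`. -/
theorem mem_span_of_xVar_mul_mem [CharZero k] {g : MvPolynomial (Fin 3 ⊕ Fin 10) k}
    (hg : xVar k 0 * g ∈ Ideal.span {fpoly k, hpoly k}) :
    g ∈ Ideal.span {fpoly k, hpoly k} := by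
  obtain ⟨a, b, hab⟩ := Ideal.mem_span_pair.1 hg
  have h0 : restrictLine k a * restrictLine k (fpoly k) +
      restrictLine k b * restrictLine k (hpoly k) = 0 := by
    rw [← map_mul, ← map_mul, ← map_add, hab]
    simp [restrictLine]
  have hdvd : restrictLine k (fpoly k) ∣ restrictLine k b * restrictLine k (hpoly k) :=
    ⟨-restrictLine k a, by linear_combination h0⟩
  obtain ⟨c, hc⟩ := (prime_restrictLine_fpoly.dvd_or_dvd hdvd).resolve_right
    not_restrictLine_fpoly_dvd
  obtain ⟨f', hf'⟩ := X_dvd_sub_restrictLine (fpoly k)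
  obtain ⟨b', hb'⟩ := X_dvd_sub_restrictLine b
  have hb : b = c * fpoly k + xVar k 0 * (b' - c * f') := by
    linear_combination hb' + hc - c * hf'
  have hx : xVar k 0 ∣ (a + c * hpoly k) * fpoly k :=
    ⟨g - (b' - c * f') * hpoly k, by linear_combination hab - hpoly k * hb⟩
  have hf : ¬ xVar k 0 ∣ fpoly k := by
    rintro ⟨q, hq⟩
    refine (prime_restrictLine_fpoly (k := k)).ne_zero ?_
    rw [hq]
    simp [restrictLine]
  obtain ⟨d, hd⟩ := (X_prime.dvd_or_dvd hx).resolve_right hf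
  refine Ideal.mem_span_pair.2 ⟨d, b' - c * f', mul_left_cancel₀ (X_ne_zero (Sum.inl 0)) ?_⟩
  linear_combination hab - hpoly k * hb - fpoly k * hd

theorem mem_span_of_xVar_pow_mul_mem [CharZero k] {g : MvPolynomial (Fin 3 ⊕ Fin 10) k} (n : ℕ)
    (hg : xVar k 0 ^ n * g ∈ Ideal.span {fpoly k, hpoly k}) :
    g ∈ Ideal.span {fpoly k, hpoly k} := by
  induction n with
  | zero => simpa using hg
  | succ n ih =>
    refine ih (mem_span_of_xVar_mul_mem ?_)
    rwa [← mul_assoc, ← pow_succ']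

theorem taylorHom_mem_span_iff [CharZero k] (c : MvPolynomial (Fin 3 ⊕ Fin 10) k) :
    taylorHom k c ∈ Ideal.span {fpoly k, hpoly k} ↔
      c ∈ Ideal.span {aVar k 0, flexForm (aVar k)} := by
  obtain ⟨e, he⟩ := xVar_sq_mul_hpoly (k := k)
  constructor
  · intro hc
    obtain ⟨u, v, huv⟩ := Ideal.mem_span_pair.1 hc
    obtain ⟨l, u', hu⟩ := exists_xVar_pow_mul_eq_taylorHom (u * xVar k 0 ^ 2 + v * e)
    obtain ⟨m, v', hv⟩ := exists_xVar_pow_mul_eq_taylorHom v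
    have key : xVar k 0 ^ (l + m + 2) * c =
        (xVar k 0 ^ m * u') * aVar k 0 - (4 * xVar k 0 ^ l * v') * flexForm (aVar k) := by
      apply taylorHom_injective
      simp only [map_mul, map_sub, map_pow, taylorHom_xVar, taylorHom_aVar_zero, map_ofNat,
        ← hu, ← hv, ← huv]
      linear_combination xVar k 0 ^ (l + m) * v * he
    refine (isPrime_span_flexForm.mem_or_mem (?_ : xVar k 0 ^ (l + m + 2) * c ∈ _)).resolve_left
      (xVar_pow_notMem_span_flexForm _)
    rw [key]
    exact sub_mem (Ideal.mul_mem_left _ _ (Ideal.subset_span (by simp)))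
      (Ideal.mul_mem_left _ _ (Ideal.subset_span (by simp)))
  · intro hc
    obtain ⟨u, v, rfl⟩ := Ideal.mem_span_pair.1 hc
    have hQ : taylorHom k (flexForm (aVar k)) ∈ Ideal.span {fpoly k, hpoly k} := by
      have h4 : (C (4⁻¹ : k) * 4 : MvPolynomial (Fin 3 ⊕ Fin 10) k) = 1 := by
        rw [← map_ofNat C 4, ← C_mul, inv_mul_cancel₀ (OfNat.ofNat_ne_zero 4), C_1]
      refine Ideal.mem_span_pair.2 ⟨C 4⁻¹ * e, -(C 4⁻¹ * xVar k 0 ^ 2), ?_⟩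
      linear_combination -C 4⁻¹ * he + taylorHom k (flexForm (aVar k)) * h4
    rw [map_add, map_mul, map_mul, taylorHom_aVar_zero]
    exact add_mem (Ideal.mul_mem_left _ _ (Ideal.subset_span (by simp)))
      (Ideal.mul_mem_left _ _ hQ)

theorem eval_eq_zero_of_mem_span {v : Fin 3 → k} {w : Fin 10 → k} (hf : cubic v w = 0)
    (hh : hessian v w = 0) {p : MvPolynomial (Fin 3 ⊕ Fin 10) k}
    (hp : p ∈ Ideal.span {fpoly k, hpoly k}) : eval (Sum.elim v w) p = 0 := by
  obtain ⟨a, b, rfl⟩ := Ideal.mem_span_pair.1 hp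
  simp [eval_fpoly, eval_hpoly, hf, hh]

theorem xVar_mul_aVar_notMem_span :
    xVar k 0 * aVar k 1 ∉ Ideal.span {fpoly k, hpoly k} := fun h => by
  simpa using eval_eq_zero_of_mem_span (v := ![1, 0, 0]) (w := ![0, 1, 0, 0, 0, 0, 0, 0, 0, 0])
    (by simp [cubic])
    (by simp [hessian, cubicD00, cubicD01, cubicD02, cubicD11, cubicD12, cubicD22]) h

variable (k) in
theorem isPrime_span_fpoly_hpoly [CharZero k] :
    (Ideal.span {fpoly k, hpoly k}).IsPrime := by
  refine ⟨fun h => xVar_mul_aVar_notMem_span (k := k) (h ▸ Submodule.mem_top), ?_⟩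
  intro a b hab
  obtain ⟨n, a', ha⟩ := exists_xVar_pow_mul_eq_taylorHom a
  obtain ⟨m, b', hb⟩ := exists_xVar_pow_mul_eq_taylorHom b
  have hmem : a' * b' ∈ Ideal.span {aVar k 0, flexForm (aVar k)} := by
    rw [← taylorHom_mem_span_iff, map_mul, ← ha, ← hb, mul_mul_mul_comm]
    exact Ideal.mul_mem_left _ _ hab
  refine (isPrime_span_flexForm.mem_or_mem hmem).imp (fun h => ?_) (fun h => ?_)
  · exact mem_span_of_xVar_pow_mul_mem n (ha ▸ (taylorHom_mem_span_iff a').2 h)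
  · exact mem_span_of_xVar_pow_mul_mem m (hb ▸ (taylorHom_mem_span_iff b').2 h)

theorem mk_mem_Flex {v : Fin 3 → k} {w : Fin 10 → k} (hv : v ≠ 0) (hw : w ≠ 0)
    (hf : eval (Sum.elim v w) (fpoly k) = 0) (hh : eval (Sum.elim v w) (hpoly k) = 0) :
    (Projectivization.mk k v hv, Projectivization.mk k w hw) ∈ Flex k := by
  intro v' w' hv' hw' hPv hPw
  obtain ⟨a, rfl⟩ := (Projectivization.mk_eq_mk_iff' k _ _ hv' hv).1 hPv
  obtain ⟨b, rfl⟩ := (Projectivization.mk_eq_mk_iff' k _ _ hw' hw).1 hPw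
  have ha : a ≠ 0 := by rintro rfl; simp at hv'
  have hb : b ≠ 0 := by rintro rfl; simp at hw'
  obtain ⟨_, _, h1⟩ := isBiHomogeneous_fpoly (k := k)
  obtain ⟨_, _, h2⟩ := isBiHomogeneous_hpoly (k := k)
  rw [h1 a b v w ha hb, h2 a b v w ha hb, hf, hh]
  simp

theorem flexIdeal_eq_span [IsAlgClosed k] [CharZero k] :
    flexIdeal k = Ideal.span {fpoly k, hpoly k} := by
  have hprime := isPrime_span_fpoly_hpoly k
  apply le_antisymm
  · refine Ideal.span_le.2 fun g ⟨_, hg⟩ => ?_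
    have hmem : xVar k 0 * aVar k 1 * g ∈ Ideal.span {fpoly k, hpoly k} := by
      rw [← IsPrime.vanishingIdeal_zeroLocus (K := k) (Ideal.span {fpoly k, hpoly k})]
      intro pt hpt
      have hf := hpt (fpoly k) (Ideal.subset_span (by simp))
      have hh := hpt (hpoly k) (Ideal.subset_span (by simp))
      obtain ⟨v, w, rfl⟩ : ∃ v w, pt = Sum.elim v w :=
        ⟨pt ∘ Sum.inl, pt ∘ Sum.inr, (Sum.elim_comp_inl_inr pt).symm⟩
      rw [aeval_eq_eval] at hf hh ⊢
      by_cases hv : v = 0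
      · simp [hv]
      by_cases hw : w = 0
      · simp [hw]
      have := hg _ (mk_mem_Flex hv hw hf hh) v w hv hw rfl rfl
      simp [this]
    exact (hprime.mem_or_mem hmem).resolve_left xVar_mul_aVar_notMem_span
  · rw [Ideal.span_le, Set.insert_subset_iff, Set.singleton_subset_iff]
    exact ⟨Ideal.subset_span ⟨isBiHomogeneous_fpoly, fun PQ h v w hv hw h1 h2 =>
        (h v w hv hw h1 h2).1⟩,
      Ideal.subset_span ⟨isBiHomogeneous_hpoly, fun PQ h v w hv hw h1 h2 =>
        (h v w hv hw h1 h2).2⟩⟩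

variable (k)

/-- **Theorem.** The ideal of the variety of flexes of plane cubics is prime and is
generated by `f` and `h`. -/
theorem flexIdeal_isPrime_and_eq_span [IsAlgClosed k] [CharZero k] :
    (flexIdeal k).IsPrime ∧ flexIdeal k = Ideal.span {fpoly k, hpoly k} := by
  rw [flexIdeal_eq_span]
  exact ⟨isPrime_span_fpoly_hpoly k, rfl⟩

end
end

section
/- The variety of flexes F of plane cubics is an ideal theoretic complete intersection of codimension 2 in P(L)×P(Φ) ≅ P^2 × P^9: F has dimension 9, and its bi-homogeneous ideal is generated by exactly 2 = codim F elements, namely f and h. -/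
noncomputable section

open MvPolynomial

variable (k : Type) [Field k]

/-- The Zariski topology on affine space `σ → K` (closed sets are zero loci of polynomials). -/
instance zariskiTopology (σ K : Type*) [CommSemiring K] : TopologicalSpace (σ → K) :=
  TopologicalSpace.generateFrom {U | ∃ p : MvPolynomial σ K, U = {x | eval x p ≠ 0}}

/-- The Zariski topology on `ℙ(L) × ℙ(Φ)`: the quotient topology induced from the
Zariski topology on the punctured affine cone `(L ∖ {0}) × (Φ ∖ {0}) ⊆ L × Φ = 𝔸¹³`. -/
instance : TopologicalSpace (Projectivization k (Fin 3 → k) × Projectivization k (Fin 10 → k)) :=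
  TopologicalSpace.coinduced
    (fun u : {x : (Fin 3 ⊕ Fin 10) → k //
        (fun i => x (Sum.inl i)) ≠ 0 ∧ (fun j => x (Sum.inr j)) ≠ 0} =>
      (Projectivization.mk k (fun i => u.1 (Sum.inl i)) u.2.1,
       Projectivization.mk k (fun j => u.1 (Sum.inr j)) u.2.2))
    inferInstance

namespace FlexVariety

/-- The coordinate ring of `L × Φ`. -/
local notation "P" k => MvPolynomial (Fin 3 ⊕ Fin 10) k

local notation "ξ" i => (X (Sum.inl i) : MvPolynomial (Fin 3 ⊕ Fin 10) _)

local notation "α" j => (X (Sum.inr j) : MvPolynomial (Fin 3 ⊕ Fin 10) _)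

section Explicit

variable (k : Type) [Field k]

theorem fpoly_eq : fpoly k =
    (α 0) * (ξ 0) ^ 3 + (α 1) * (ξ 1) ^ 3 + (α 2) * (ξ 2) ^ 3 + (α 3) * (ξ 0) ^ 2 * (ξ 1)
      + (α 4) * (ξ 0) ^ 2 * (ξ 2) + (α 5) * (ξ 0) * (ξ 1) ^ 2 + (α 6) * (ξ 1) ^ 2 * (ξ 2)
      + (α 7) * (ξ 0) * (ξ 2) ^ 2 + (α 8) * (ξ 1) * (ξ 2) ^ 2 + (α 9) * (ξ 0) * (ξ 1) * (ξ 2) := by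
  simp [fpoly, Fin.sum_univ_succ, Fin.prod_univ_succ, cubicExp, Fin.succ]
  ring

/-- The derivative `∂f/∂x₁`. -/
def deriv₁ : P k :=
  3 * (α 1) * (ξ 1) ^ 2 + (α 3) * (ξ 0) ^ 2 + 2 * (α 5) * (ξ 0) * (ξ 1) + 2 * (α 6) * (ξ 1) * (ξ 2)
    + (α 8) * (ξ 2) ^ 2 + (α 9) * (ξ 0) * (ξ 2)

/-- The derivative `∂f/∂x₂`. -/
def deriv₂ : P k :=
  3 * (α 2) * (ξ 2) ^ 2 + (α 4) * (ξ 0) ^ 2 + (α 6) * (ξ 1) ^ 2 + 2 * (α 7) * (ξ 0) * (ξ 2)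
    + 2 * (α 8) * (ξ 1) * (ξ 2) + (α 9) * (ξ 0) * (ξ 1)

/-- Half of `∂²f/∂x₁²`. -/
def halfDeriv₁₁ : P k := 3 * (α 1) * (ξ 1) + (α 5) * (ξ 0) + (α 6) * (ξ 2)

/-- Half of `∂²f/∂x₂²`. -/
def halfDeriv₂₂ : P k := 3 * (α 2) * (ξ 2) + (α 7) * (ξ 0) + (α 8) * (ξ 1)

/-- The mixed derivative `∂²f/∂x₁∂x₂`. -/
def deriv₁₂ : P k := 2 * (α 6) * (ξ 1) + 2 * (α 8) * (ξ 2) + (α 9) * (ξ 0)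

/-- The Hessian matrix of the generic cubic, written out. -/
def hessian : Matrix (Fin 3) (Fin 3) (P k) :=
  let f₀₀ := 6 * (α 0) * (ξ 0) + 2 * (α 3) * (ξ 1) + 2 * (α 4) * (ξ 2)
  let f₀₁ := 2 * (α 3) * (ξ 0) + 2 * (α 5) * (ξ 1) + (α 9) * (ξ 2)
  let f₀₂ := 2 * (α 4) * (ξ 0) + 2 * (α 7) * (ξ 2) + (α 9) * (ξ 1)
  !![f₀₀, f₀₁, f₀₂;
    f₀₁, 2 * halfDeriv₁₁ k, deriv₁₂ k;
    f₀₂, deriv₁₂ k, 2 * halfDeriv₂₂ k]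

theorem hpoly_eq : hpoly k = (hessian k).det := by
  have key : (Matrix.of fun i j : Fin 3 =>
      pderiv (Sum.inl i) (pderiv (Sum.inl j) (fpoly k))) = hessian k := by
    ext1 i j
    have h₂ (l : Fin 3 ⊕ Fin 10) : pderiv l (2 : P k) = 0 := (pderiv l).map_natCast 2
    have h₃ (l : Fin 3 ⊕ Fin 10) : pderiv l (3 : P k) = 0 := (pderiv l).map_natCast 3
    rw [fpoly_eq]
    fin_cases i <;> fin_cases j <;>
    · simp [hessian, halfDeriv₁₁, halfDeriv₂₂, deriv₁₂, Derivation.leibniz,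
        Derivation.leibniz_pow, pderiv_X, Pi.single_apply, h₂, h₃]
      try ring
  rw [hpoly, key]

theorem sq_mul_hpoly : (ξ 0) ^ 2 * hpoly k =
    6 * fpoly k * (4 * halfDeriv₁₁ k * halfDeriv₂₂ k - deriv₁₂ k ^ 2)
      - 8 * (deriv₁ k ^ 2 * halfDeriv₂₂ k - deriv₁ k * deriv₂ k * deriv₁₂ k
        + deriv₂ k ^ 2 * halfDeriv₁₁ k) := by
  rw [hpoly_eq, Matrix.det_fin_three, fpoly_eq]
  simp only [hessian, halfDeriv₁₁, halfDeriv₂₂, deriv₁₂, deriv₁, deriv₂, Matrix.of_apply,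
    Matrix.cons_val', Matrix.cons_val_zero, Matrix.cons_val_one, Matrix.cons_val]
  ring

theorem eval_fpoly (a b : k) (v : Fin 3 → k) (w : Fin 10 → k) :
    eval (Sum.elim (a • v) (b • w)) (fpoly k) = a ^ 3 * b ^ 1 * eval (Sum.elim v w) (fpoly k) := by
  simp [fpoly_eq]
  ring

theorem isBiHomogeneous_fpoly : IsBiHomogeneous k (fpoly k) :=
  ⟨3, 1, fun a b v w _ _ => eval_fpoly k a b v w⟩

theorem isBiHomogeneous_hpoly : IsBiHomogeneous k (hpoly k) := by
  refine ⟨3, 3, fun a b v w _ _ => ?_⟩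
  have key : (hessian k).map (eval (Sum.elim (a • v) (b • w))) =
      (a * b) • (hessian k).map (eval (Sum.elim v w)) := by
    ext i j
    fin_cases i <;> fin_cases j <;>
    · simp [hessian, halfDeriv₁₁, halfDeriv₂₂, deriv₁₂]
      ring
  have := congrArg Matrix.det key
  rw [Matrix.det_smul, ← RingHom.mapMatrix_apply, ← RingHom.mapMatrix_apply,
    ← RingHom.map_det, ← RingHom.map_det, ← hpoly_eq, Fintype.card_fin, mul_pow] at this
  exact this

end Explicit

section Primes

variable {k : Type} [Field k] {σ : Type*}

theorem prime_X_pow_mul_X_add {i j : σ} (hij : i ≠ j) (n : ℕ) {g : MvPolynomial σ k}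
    (hg : g ∈ supported k ({j}ᶜ : Set σ)) (u : σ → k) (hu : u i = 0) (hgu : eval u g ≠ 0) :
    Prime (X i ^ n * X j + g) := by
  classical
  have not_mem_vars {p : MvPolynomial σ k} (hp : p ∈ supported k ({j}ᶜ : Set σ)) : j ∉ p.vars :=
    fun h => mem_supported.1 hp h rfl
  refine (irreducible_mul_X_add _ g j (pow_ne_zero _ (X_ne_zero i)) (not_mem_vars ?_)
    (not_mem_vars hg) ?_).prime
  · exact pow_mem (X_mem_supported.2 hij) n
  · refine IsRelPrime.pow_left ((Irreducible.isRelPrime_iff_not_dvd X_prime.irreducible).2 ?_)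
    rintro ⟨c, rfl⟩
    simp [hu] at hgu

theorem isPrime_span_X_pair [DecidableEq σ] (i : σ) (p : MvPolynomial σ k)
    (hp : Prime (aeval (fun j => if j = i then 0 else X j : σ → MvPolynomial σ k) p)) :
    (Ideal.span {X i, p}).IsPrime := by
  set ε : MvPolynomial σ k →ₐ[k] MvPolynomial σ k := aeval (fun j => if j = i then 0 else X j)
    with hε
  have hsub (g : MvPolynomial σ k) : X i ∣ g - ε g := by
    rw [← Ideal.mem_span_singleton, ← Ideal.Quotient.eq]
    have : (Ideal.Quotient.mkₐ k (Ideal.span {(X i : MvPolynomial σ k)})).comp ε =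
        Ideal.Quotient.mkₐ k _ := by
      ext j
      by_cases h : j = i
      · subst h
        have : Ideal.Quotient.mk (Ideal.span {(X j : MvPolynomial σ k)}) (X j) = 0 :=
          Ideal.Quotient.eq_zero_iff_mem.2 (Ideal.mem_span_singleton_self _)
        simp [hε, this]
      · simp [hε, h]
    exact (DFunLike.congr_fun this g).symm
  have hεX : ε (X i) = 0 := by simp [hε]
  have hεε (g : MvPolynomial σ k) : ε (ε g) = ε g := by
    obtain ⟨c, hc⟩ := hsub g
    have := congrArg ε hc
    simp only [map_sub, map_mul, hεX, zero_mul, sub_eq_zero] at this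
    exact this.symm
  have hprime : (Ideal.span {ε p}).IsPrime := (Ideal.span_singleton_prime hp.ne_zero).2 hp
  have heq : Ideal.span {X i, p} = (Ideal.span {ε p}).comap ε := by
    ext g
    rw [Ideal.mem_comap, Ideal.mem_span_singleton', Ideal.mem_span_pair]
    constructor
    · rintro ⟨a, b, rfl⟩
      exact ⟨ε b, by simp [hεX]⟩
    · rintro ⟨c, hc⟩
      obtain ⟨d, hd⟩ := hsub (g - c * p)
      refine ⟨d, c, ?_⟩
      have : ε (g - c * p) = ε (c * 0) := by
        have h1 := congrArg ε hc
        rw [map_mul, hεε, hεε] at h1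
        simp [← h1]
      rw [this] at hd
      simp only [mul_zero, map_zero, sub_zero] at hd
      linear_combination -hd
  rw [heq]
  exact Ideal.comap_isPrime ε _

end Primes

section Explicit

variable (k : Type) [Field k]

theorem prime_fpoly : Prime (fpoly k) := by
  have key : fpoly k = (ξ 0) ^ 3 * (α 0) + ((α 1) * (ξ 1) ^ 3 + (α 2) * (ξ 2) ^ 3
      + (α 3) * (ξ 0) ^ 2 * (ξ 1) + (α 4) * (ξ 0) ^ 2 * (ξ 2) + (α 5) * (ξ 0) * (ξ 1) ^ 2
      + (α 6) * (ξ 1) ^ 2 * (ξ 2) + (α 7) * (ξ 0) * (ξ 2) ^ 2 + (α 8) * (ξ 1) * (ξ 2) ^ 2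
      + (α 9) * (ξ 0) * (ξ 1) * (ξ 2)) := by
    rw [fpoly_eq]
    ring
  rw [key]
  refine prime_X_pow_mul_X_add (by simp) 3 ?_ (Sum.elim ![0, 1, 0] 1) (by simp) (by simp)
  repeat' first
    | with_reducible apply add_mem
    | with_reducible refine pow_mem ?_ _
    | with_reducible apply mul_mem
    | exact X_mem_supported.2 (by simp)

theorem isPrime_span_X_fpoly : (Ideal.span {ξ 0, fpoly k}).IsPrime := by
  apply isPrime_span_X_pair
  have key : aeval (fun j => if j = Sum.inl 0 then 0 else X j : _ → P k) (fpoly k) =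
      (ξ 1) ^ 3 * (α 1) + ((α 2) * (ξ 2) ^ 3 + (α 6) * (ξ 1) ^ 2 * (ξ 2)
        + (α 8) * (ξ 1) * (ξ 2) ^ 2) := by
    rw [fpoly_eq]
    simp only [map_add, map_mul, map_pow, aeval_X, if_true, reduceCtorEq, if_false,
      Sum.inl.injEq, Fin.isValue, one_ne_zero, Fin.reduceEq]
    ring
  rw [key]
  refine prime_X_pow_mul_X_add (by simp) 3 ?_ (Sum.elim ![0, 0, 1] 1) (by simp) (by simp)
  repeat' first
    | with_reducible apply add_mem
    | with_reducible refine pow_mem ?_ _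
    | with_reducible apply mul_mem
    | exact X_mem_supported.2 (by simp)

/-- The equation satisfied by the cubics `f` with `f(1, 0, 0) = 0` having a flex at `(1, 0, 0)`. -/
def flexCubic : P k := (α 3) ^ 2 * (α 7) - (α 3) * (α 4) * (α 9) + (α 4) ^ 2 * (α 5)

theorem isPrime_span_X_flexCubic : (Ideal.span {α 0, flexCubic k}).IsPrime := by
  apply isPrime_span_X_pair
  have key : aeval (fun j => if j = Sum.inr 0 then 0 else X j : _ → P k) (flexCubic k) =
      (α 3) ^ 2 * (α 7) + ((α 4) ^ 2 * (α 5) - (α 3) * (α 4) * (α 9)) := by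
    simp [flexCubic]
    ring
  rw [key]
  refine prime_X_pow_mul_X_add (by simp) 2 ?_ (Sum.elim 1 ![1, 1, 1, 0, 1, 1, 1, 1, 1, 1])
    (by simp) (by simp)
  repeat' first
    | with_reducible apply add_mem
    | with_reducible apply sub_mem
    | with_reducible refine pow_mem ?_ _
    | with_reducible apply mul_mem
    | exact X_mem_supported.2 (by simp)

theorem hpoly_notMem_span_X_fpoly [CharZero k] : hpoly k ∉ Ideal.span {ξ 0, fpoly k} := by
  intro h
  obtain ⟨a, b, hab⟩ := Ideal.mem_span_pair.1 h
  have := congrArg (eval (Sum.elim ![0, 1, 0] ![0, 0, 0, 0, 0, 1, 0, 0, 1, 0])) hab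
  rw [hpoly_eq, Matrix.det_fin_three, fpoly_eq] at this
  simp [hessian, halfDeriv₁₁, halfDeriv₂₂, deriv₁₂] at this

theorem mem_span_of_X_mul_mem [CharZero k] {g : P k}
    (hg : (ξ 0) * g ∈ Ideal.span {fpoly k, hpoly k}) : g ∈ Ideal.span {fpoly k, hpoly k} := by
  obtain ⟨a, b, hab⟩ := Ideal.mem_span_pair.1 hg
  have hb : b ∈ Ideal.span {ξ 0, fpoly k} := by
    refine ((isPrime_span_X_fpoly k).mem_or_mem (y := hpoly k) ?_).resolve_right
      (hpoly_notMem_span_X_fpoly k)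
    exact Ideal.mem_span_pair.2 ⟨g, -a, by linear_combination -hab⟩
  obtain ⟨b', c, rfl⟩ := Ideal.mem_span_pair.1 hb
  have hdvd : (ξ 0) ∣ (a + c * hpoly k) * fpoly k :=
    ⟨g - b' * hpoly k, by linear_combination hab⟩
  have hndvd : ¬ (ξ 0) ∣ fpoly k := by
    rintro ⟨d, hd⟩
    have := congrArg (eval (Sum.elim ![0, 1, 0] 1)) hd
    simp [fpoly_eq] at this
  obtain ⟨a', ha'⟩ := (X_prime.dvd_or_dvd hdvd).resolve_right hndvd
  refine Ideal.mem_span_pair.2 ⟨a', b', mul_left_cancel₀ (X_ne_zero (Sum.inl 0)) ?_⟩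
  linear_combination hab - fpoly k * ha'

theorem mem_span_of_X_pow_mul_mem [CharZero k] {g : P k} (n : ℕ)
    (hg : (ξ 0) ^ n * g ∈ Ideal.span {fpoly k, hpoly k}) :
    g ∈ Ideal.span {fpoly k, hpoly k} := by
  induction n with
  | zero => simpa using hg
  | succ n ih =>
    rw [pow_succ', mul_assoc] at hg
    exact ih (mem_span_of_X_mul_mem k hg)

end Explicit

section Normalization

variable (k : Type) [Field k]

/-- The coefficients of `f(y₀ x + (0, y₁, y₂))` as a polynomial in `y`. -/
def taylorCoeff : Fin 10 → P k :=
  ![fpoly k, α 1, α 2, deriv₁ k, deriv₂ k, halfDeriv₁₁ k, α 6, halfDeriv₂₂ k, α 8, deriv₁₂ k]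

/-- The Taylor expansion of the generic cubic `f` at the point `x`. -/
def taylor : (P k) →ₐ[k] P k := aeval (Sum.elim (fun i => ξ i) (taylorCoeff k))

theorem taylor_inl (i : Fin 3) : taylor k (ξ i) = ξ i := by simp [taylor]

theorem taylor_inr (j : Fin 10) : taylor k (α j) = taylorCoeff k j := by simp [taylor]

/-- The coefficients of `f(y₀, x₀ y₁ - x₁ y₀, x₀ y₂ - x₂ y₀)` as a polynomial in `y`. -/
def untaylorCoeff : Fin 10 → P k :=
    ![(α 0) - (α 3) * (ξ 1) - (α 4) * (ξ 2) + (α 5) * (ξ 1) ^ 2 + (α 7) * (ξ 2) ^ 2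
        + (α 9) * (ξ 1) * (ξ 2) - (α 1) * (ξ 1) ^ 3 - (α 2) * (ξ 2) ^ 3
        - (α 6) * (ξ 1) ^ 2 * (ξ 2) - (α 8) * (ξ 1) * (ξ 2) ^ 2,
      (ξ 0) ^ 3 * (α 1),
      (ξ 0) ^ 3 * (α 2),
      (ξ 0) * ((α 3) + 3 * (ξ 1) ^ 2 * (α 1) - 2 * (ξ 1) * (α 5) + 2 * (ξ 1) * (ξ 2) * (α 6)
        + (ξ 2) ^ 2 * (α 8) - (ξ 2) * (α 9)),
      (ξ 0) * ((α 4) + 3 * (ξ 2) ^ 2 * (α 2) - 2 * (ξ 2) * (α 7) + 2 * (ξ 1) * (ξ 2) * (α 8)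
        + (ξ 1) ^ 2 * (α 6) - (ξ 1) * (α 9)),
      (ξ 0) ^ 2 * ((α 5) - 3 * (ξ 1) * (α 1) - (ξ 2) * (α 6)),
      (ξ 0) ^ 3 * (α 6),
      (ξ 0) ^ 2 * ((α 7) - 3 * (ξ 2) * (α 2) - (ξ 1) * (α 8)),
      (ξ 0) ^ 3 * (α 8),
      (ξ 0) ^ 2 * ((α 9) - 2 * (ξ 1) * (α 6) - 2 * (ξ 2) * (α 8))]

/-- The inverse of `taylor` up to powers of `x₀`. -/
def untaylor : (P k) →ₐ[k] P k := aeval (Sum.elim (fun i => ξ i) (untaylorCoeff k))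

theorem untaylor_inl (i : Fin 3) : untaylor k (ξ i) = ξ i := by simp [untaylor]

theorem untaylor_inr (j : Fin 10) : untaylor k (α j) = untaylorCoeff k j := by simp [untaylor]

theorem taylor_untaylor (g : P k) : taylor k (untaylor k g) =
    aeval (Sum.elim (fun i => ξ i) (fun j => (ξ 0) ^ 3 * (α j))) g := by
  rw [← AlgHom.comp_apply]
  congr 1
  ext1 i
  rcases i with i | j
  · simp [taylor_inl, untaylor_inl]
  · fin_cases j <;>
    · simp [map_ofNat, taylor_inl, taylor_inr, untaylor_inr, untaylorCoeff, taylorCoeff, fpoly_eq, deriv₁, deriv₂, halfDeriv₁₁, halfDeriv₂₂, deriv₁₂]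
      try ring

theorem untaylor_fpoly : untaylor k (fpoly k) = (ξ 0) ^ 3 * (α 0) := by
  simp [untaylor_inl, untaylor_inr, untaylorCoeff, fpoly_eq]
  ring

theorem untaylor_sq_mul_hpoly : (ξ 0) ^ 2 * untaylor k (hpoly k) =
    6 * (ξ 0) ^ 9 * (α 0) * (4 * (α 5) * (α 7) - (α 9) ^ 2) - 8 * (ξ 0) ^ 9 * flexCubic k := by
  have h₁ : untaylor k (deriv₁ k) = (ξ 0) ^ 3 * (α 3) := by simp [map_ofNat, untaylor_inl, untaylor_inr, untaylorCoeff, deriv₁]; ring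
  have h₂ : untaylor k (deriv₂ k) = (ξ 0) ^ 3 * (α 4) := by simp [map_ofNat, untaylor_inl, untaylor_inr, untaylorCoeff, deriv₂]; ring
  have h₁₁ : untaylor k (halfDeriv₁₁ k) = (ξ 0) ^ 3 * (α 5) := by
    simp [map_ofNat, untaylor_inl, untaylor_inr, untaylorCoeff, halfDeriv₁₁]; ring
  have h₂₂ : untaylor k (halfDeriv₂₂ k) = (ξ 0) ^ 3 * (α 7) := by
    simp [map_ofNat, untaylor_inl, untaylor_inr, untaylorCoeff, halfDeriv₂₂]; ring
  have h₁₂ : untaylor k (deriv₁₂ k) = (ξ 0) ^ 3 * (α 9) := by simp [map_ofNat, untaylor_inl, untaylor_inr, untaylorCoeff, deriv₁₂]; ring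
  have hx : untaylor k (ξ 0) = ξ 0 := untaylor_inl k 0
  have := congrArg (untaylor k) (sq_mul_hpoly k)
  simp only [map_mul, map_sub, map_add, map_pow, map_ofNat, untaylor_fpoly, h₁, h₂, h₁₁, h₂₂,
    h₁₂, hx] at this
  rw [this, flexCubic]
  ring

theorem taylor_flexCubic_mem [CharZero k] :
    taylor k (flexCubic k) ∈ Ideal.span {fpoly k, hpoly k} := by
  have h : taylor k (flexCubic k) = deriv₁ k ^ 2 * halfDeriv₂₂ k - deriv₁ k * deriv₂ k * deriv₁₂ k
        + deriv₂ k ^ 2 * halfDeriv₁₁ k := by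
    simp [taylor_inr, taylorCoeff, flexCubic]
  have h8 : (C (8⁻¹ : k) : P k) * 8 = 1 := by
    rw [← map_ofNat (C : k →+* P k), ← C_mul, inv_mul_cancel₀ (by norm_num), C_1]
  refine Ideal.mem_span_pair.2
    ⟨C 8⁻¹ * 6 * (4 * halfDeriv₁₁ k * halfDeriv₂₂ k - deriv₁₂ k ^ 2), -(C 8⁻¹ * (ξ 0) ^ 2), ?_⟩
  rw [h]
  linear_combination (-(C 8⁻¹)) * sq_mul_hpoly k + (deriv₁ k ^ 2 * halfDeriv₂₂ k
    - deriv₁ k * deriv₂ k * deriv₁₂ k + deriv₂ k ^ 2 * halfDeriv₁₁ k) * h8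

end Normalization

section Ideal

variable {k : Type} [Field k]

theorem eval_aeval_eq {σ τ : Type*} (F : σ → MvPolynomial τ k) (u : τ → k)
    (p : MvPolynomial σ k) : eval u (aeval F p) = eval (fun i => eval u (F i)) p := by
  induction p using MvPolynomial.induction_on with
  | C a => simp
  | add p q hp hq => rw [map_add, map_add, map_add, hp, hq]
  | mul_X p i hp => rw [map_mul, map_mul, map_mul, hp, aeval_X, eval_X]

theorem eval_eq_zero_iff_of_mk_eq {g : P k} (hg : IsBiHomogeneous k g) {v v' : Fin 3 → k}
    {w w' : Fin 10 → k} (hv : v ≠ 0) (hv' : v' ≠ 0) (hw : w ≠ 0) (hw' : w' ≠ 0)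
    (hvv' : Projectivization.mk k v hv = Projectivization.mk k v' hv')
    (hww' : Projectivization.mk k w hw = Projectivization.mk k w' hw') :
    eval (Sum.elim v w) g = 0 ↔ eval (Sum.elim v' w') g = 0 := by
  obtain ⟨d, e, h⟩ := hg
  obtain ⟨a, rfl⟩ := (Projectivization.mk_eq_mk_iff' k _ _ hv hv').1 hvv'
  obtain ⟨b, rfl⟩ := (Projectivization.mk_eq_mk_iff' k _ _ hw hw').1 hww'
  have ha : a ≠ 0 := by rintro rfl; simp at hv
  have hb : b ≠ 0 := by rintro rfl; simp at hw
  rw [h a b v' w' ha hb]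
  simp [ha, hb]

theorem mk_mem_flex_iff {v : Fin 3 → k} {w : Fin 10 → k} (hv : v ≠ 0) (hw : w ≠ 0) :
    (Projectivization.mk k v hv, Projectivization.mk k w hw) ∈ Flex k ↔
      eval (Sum.elim v w) (fpoly k) = 0 ∧ eval (Sum.elim v w) (hpoly k) = 0 := by
  refine ⟨fun h => h v w hv hw rfl rfl, fun h v' w' hv' hw' hvv' hww' => ⟨?_, ?_⟩⟩
  · exact (eval_eq_zero_iff_of_mk_eq (isBiHomogeneous_fpoly k) hv' hv hw' hw hvv' hww').2 h.1
  · exact (eval_eq_zero_iff_of_mk_eq (isBiHomogeneous_hpoly k) hv' hv hw' hw hvv' hww').2 h.2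

theorem untaylor_mem_of_vanishesOn [IsAlgClosed k] [CharZero k] {g : P k}
    (hg : VanishesOn k g (Flex k)) : untaylor k g ∈ Ideal.span {α 0, flexCubic k} := by
  have hprime := isPrime_span_X_flexCubic k
  have hmem : untaylor k g * ((ξ 0) * (α 1)) ∈ Ideal.span {α 0, flexCubic k} := by
    rw [← IsPrime.vanishingIdeal_zeroLocus (K := k) (Ideal.span {α 0, flexCubic k}),
      mem_vanishingIdeal_iff]
    intro u hu
    rw [zeroLocus_span] at hu
    have h₀ : u (Sum.inr 0) = 0 := by simpa using hu (α 0) (by simp)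
    have hq : eval u (flexCubic k) = 0 := by simpa using hu (flexCubic k) (by simp)
    change eval u _ = 0
    by_cases hx : u (Sum.inl 0) = 0
    · simp [hx]
    by_cases hα : u (Sum.inr 1) = 0
    · simp [hα]
    have heval (p : P k) : eval u (untaylor k p) =
        eval (Sum.elim (fun i => u (Sum.inl i)) (fun j => eval u (untaylorCoeff k j))) p := by
      rw [untaylor, eval_aeval_eq]
      congr 2
      ext (i | j) <;> simp
    have hv : (fun i => u (Sum.inl i)) ≠ 0 := fun h => hx (congrFun h 0)
    have hw : (fun j => eval u (untaylorCoeff k j)) ≠ 0 := fun h => by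
      have := congrFun h 1
      simp [untaylorCoeff, hx, hα] at this
    have hf : eval u (untaylor k (fpoly k)) = 0 := by simp [untaylor_fpoly, h₀]
    have hh : eval u (untaylor k (hpoly k)) = 0 := by
      have := congrArg (eval u) (untaylor_sq_mul_hpoly k)
      simpa [hq, h₀, hx] using this
    rw [heval] at hf hh
    have := hg _ ((mk_mem_flex_iff hv hw).2 ⟨hf, hh⟩) _ _ hv hw rfl rfl
    rw [map_mul, heval, this, zero_mul]
  refine (hprime.mem_or_mem hmem).resolve_right fun h => ?_
  obtain ⟨a, b, hab⟩ := Ideal.mem_span_pair.1 h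
  have := congrArg (eval (Sum.elim 1 ![0, 1, 0, 0, 0, 0, 0, 0, 0, 0])) hab
  simp [flexCubic] at this

theorem taylor_untaylor_of_isBiHomogeneous [CharZero k] {g : P k} (hg : IsBiHomogeneous k g) :
    ∃ n, taylor k (untaylor k g) = (ξ 0) ^ n * g := by
  obtain ⟨d, e, h⟩ := hg
  refine ⟨3 * e, mul_left_cancel₀ (X_ne_zero (Sum.inl 0)) (funext fun u => ?_)⟩
  by_cases hx : u (Sum.inl 0) = 0
  · simp [hx]
  have hu : Sum.elim (fun i => u (Sum.inl i)) (fun j => u (Sum.inr j)) = u := by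
    ext (i | j) <;> rfl
  have key := h 1 (u (Sum.inl 0) ^ 3) (fun i => u (Sum.inl i)) (fun j => u (Sum.inr j))
    one_ne_zero (pow_ne_zero 3 hx)
  rw [hu, one_pow, one_mul, ← pow_mul] at key
  rw [taylor_untaylor, map_mul, map_mul, map_mul, map_pow, eval_X, ← key, eval_aeval_eq]
  congr 3
  ext (i | j) <;> simp

theorem flexIdeal_eq [IsAlgClosed k] [CharZero k] :
    flexIdeal k = Ideal.span {fpoly k, hpoly k} := by
  apply le_antisymm
  · rw [flexIdeal, Ideal.span_le]
    rintro g ⟨hbi, hg⟩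
    obtain ⟨n, hn⟩ := taylor_untaylor_of_isBiHomogeneous hbi
    obtain ⟨a, b, hab⟩ := Ideal.mem_span_pair.1 (untaylor_mem_of_vanishesOn hg)
    refine mem_span_of_X_pow_mul_mem k n ?_
    rw [← hn, ← hab, map_add, map_mul, map_mul, taylor_inr]
    exact add_mem (Ideal.mul_mem_left _ _ (Ideal.subset_span (by simp [taylorCoeff])))
      (Ideal.mul_mem_left _ _ (taylor_flexCubic_mem k))
  · rw [Ideal.span_le]
    rintro g (rfl | rfl)
    · exact Ideal.subset_span ⟨isBiHomogeneous_fpoly k,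
        fun Q hQ v w hv hw h₁ h₂ => (hQ v w hv hw h₁ h₂).1⟩
    · exact Ideal.subset_span ⟨isBiHomogeneous_hpoly k,
        fun Q hQ v w hv hw h₁ h₂ => (hQ v w hv hw h₁ h₂).2⟩

end Ideal

open TopologicalSpace Topology Order

section Zariski

variable {k : Type} [Field k] {σ : Type}

theorem isTopologicalBasis_zariski :
    IsTopologicalBasis {U : Set (σ → k) | ∃ p : MvPolynomial σ k, U = {x | eval x p ≠ 0}} where
  exists_subset_inter := by
    rintro _ ⟨p, rfl⟩ _ ⟨q, rfl⟩ x hx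
    refine ⟨_, ⟨p * q, rfl⟩, ?_, fun y hy => ?_⟩
    · simpa using hx
    · simpa using hy
  sUnion_eq := Set.eq_univ_of_forall fun x => ⟨_, ⟨1, rfl⟩, by simp⟩
  eq_generateFrom := rfl

theorem isOpen_ne_zero (p : MvPolynomial σ k) : IsOpen {x : σ → k | eval x p ≠ 0} :=
  isTopologicalBasis_zariski.isOpen ⟨p, rfl⟩

theorem isClosed_eq_zero (p : MvPolynomial σ k) : IsClosed {x : σ → k | eval x p = 0} := by
  rw [← isOpen_compl_iff]
  exact isOpen_ne_zero p

theorem zeroLocus_eq_iInter (I : Ideal (MvPolynomial σ k)) :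
    zeroLocus k I = ⋂ p ∈ I, {x | eval x p = 0} := by
  ext x
  simp only [mem_zeroLocus_iff, Set.mem_iInter]
  rfl

theorem isClosed_zeroLocus (I : Ideal (MvPolynomial σ k)) : IsClosed (zeroLocus k I) := by
  rw [zeroLocus_eq_iInter]
  exact isClosed_biInter fun p _ => isClosed_eq_zero p

theorem mem_vanishingIdeal_iff_eval {Z : Set (σ → k)} {p : MvPolynomial σ k} :
    p ∈ vanishingIdeal k Z ↔ ∀ x ∈ Z, eval x p = 0 := by
  rw [mem_vanishingIdeal_iff]; rfl

theorem zeroLocus_vanishingIdeal {Z : Set (σ → k)} (hZ : IsClosed Z) :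
    zeroLocus k (vanishingIdeal k Z) = Z := by
  refine Set.Subset.antisymm (fun x hx => ?_) fun x hx p hp => mem_vanishingIdeal_iff.1 hp x hx
  by_contra hxZ
  obtain ⟨_, ⟨p, rfl⟩, hpx, hp⟩ :=
    isTopologicalBasis_zariski.exists_subset_of_mem_open (show x ∈ Zᶜ from hxZ) hZ.isOpen_compl
  exact hpx (hx p (mem_vanishingIdeal_iff_eval.2 fun y hy => not_not.1 fun h => hp h hy))

theorem isPrime_vanishingIdeal {Z : Set (σ → k)} (hZ : IsIrreducible Z) :
    (vanishingIdeal k Z).IsPrime := by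
  refine Ideal.isPrime_iff.2 ⟨fun h => ?_, fun {p q} hpq => ?_⟩
  · obtain ⟨x, hx⟩ := hZ.nonempty
    simpa using mem_vanishingIdeal_iff_eval.1 ((Ideal.eq_top_iff_one _).1 h) x hx
  · have := (isPreirreducible_iff_isClosed_union_isClosed.1 hZ.isPreirreducible) _ _
      (isClosed_eq_zero p) (isClosed_eq_zero q) fun x hx => by
        simpa using mem_vanishingIdeal_iff_eval.1 hpq x hx
    rwa [mem_vanishingIdeal_iff_eval, mem_vanishingIdeal_iff_eval]

theorem isIrreducible_zeroLocus [IsAlgClosed k] [Finite σ] (I : Ideal (MvPolynomial σ k))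
    [I.IsPrime] : IsIrreducible (zeroLocus k I) := by
  have hI := IsPrime.vanishingIdeal_zeroLocus (K := k) I
  constructor
  · by_contra h
    rw [Set.not_nonempty_iff_eq_empty.1 h, vanishingIdeal_empty] at hI
    exact Ideal.IsPrime.ne_top ‹_› hI.symm
  · rw [isPreirreducible_iff_isClosed_union_isClosed]
    intro Z W hZ hW hZW
    have hmul : vanishingIdeal k Z * vanishingIdeal k W ≤ I := by
      refine Ideal.mul_le.2 fun p hp q hq => hI ▸ mem_vanishingIdeal_iff_eval.2 fun x hx => ?_
      rw [map_mul]
      rcases hZW hx with hx | hx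
      · rw [mem_vanishingIdeal_iff_eval.1 hp x hx, zero_mul]
      · rw [mem_vanishingIdeal_iff_eval.1 hq x hx, mul_zero]
    rw [← zeroLocus_vanishingIdeal hZ, ← zeroLocus_vanishingIdeal hW]
    exact ((Ideal.IsPrime.mul_le ‹_›).1 hmul).imp zeroLocus_anti_mono zeroLocus_anti_mono

theorem continuous_of_polynomial {Y : Type*} [TopologicalSpace Y] {f : Y → σ → k}
    (h : ∀ p : MvPolynomial σ k, IsOpen {y | eval (f y) p ≠ 0}) : Continuous f :=
  continuous_generateFrom_iff.2 (by rintro _ ⟨p, rfl⟩; exact h p)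

theorem topologicalKrullDim_affine_le [Finite σ] :
    topologicalKrullDim (σ → k) ≤ Nat.card σ := by
  refine (krullDim_le_of_strictMono
    (fun Z : IrreducibleCloseds (σ → k) => OrderDual.toDual
      (⟨vanishingIdeal k Z.1, isPrime_vanishingIdeal Z.isIrreducible⟩ :
        PrimeSpectrum (MvPolynomial σ k))) (fun Z W hZW => ?_)).trans_eq ?_
  ·
    rw [OrderDual.toDual_lt_toDual]
    refine lt_of_le_of_ne (vanishingIdeal_anti_mono hZW.le) fun h => hZW.ne ?_
    refine SetLike.coe_injective ?_
    have h' := congrArg (fun Q => zeroLocus k Q.asIdeal) h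
    exact (zeroLocus_vanishingIdeal Z.isClosed).symm.trans
      (h'.symm.trans (zeroLocus_vanishingIdeal W.isClosed))
  rw [krullDim_orderDual]
  have := MvPolynomial.ringKrullDim_of_isNoetherianRing (R := k) (ι := σ)
  rw [ringKrullDim_eq_zero_of_field, zero_add] at this
  exact this

theorem isIrreducible_preimage_of_isInducing {Y Z : Type*} [TopologicalSpace Y]
    [TopologicalSpace Z] {f : Y → Z} (hf : IsInducing f) {S : Set Z} (hS : IsIrreducible S)
    (hSf : S ⊆ Set.range f) : IsIrreducible (f ⁻¹' S) := by
  constructor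
  · obtain ⟨z, hz⟩ := hS.nonempty
    obtain ⟨y, rfl⟩ := hSf hz
    exact ⟨y, hz⟩
  · intro U V hU hV
    obtain ⟨U', hU', rfl⟩ := hf.isOpen_iff.1 hU
    obtain ⟨V', hV', rfl⟩ := hf.isOpen_iff.1 hV
    rintro ⟨x, hxS, hxU⟩ ⟨y, hyS, hyV⟩
    obtain ⟨z, hzS, hz⟩ := hS.isPreirreducible U' V' hU' hV' ⟨_, hxS, hxU⟩ ⟨_, hyS, hyV⟩
    obtain ⟨z, rfl⟩ := hSf hzS
    exact ⟨z, hzS, hz⟩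

theorem ringKrullDim_quotient_le_topologicalKrullDim [IsAlgClosed k] [Finite σ]
    (I : Ideal (MvPolynomial σ k)) :
    ringKrullDim (MvPolynomial σ k ⧸ I) ≤ topologicalKrullDim (zeroLocus k I) := by
  rw [ringKrullDim_quotient, ← krullDim_orderDual]
  refine krullDim_le_of_strictMono (fun Q : (PrimeSpectrum.zeroLocus (I : Set _))ᵒᵈ =>
    (⟨Subtype.val ⁻¹' zeroLocus k (OrderDual.ofDual Q).1.asIdeal,
      isIrreducible_preimage_of_isInducing IsInducing.subtypeVal (isIrreducible_zeroLocus _)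
        (by rw [Subtype.range_coe]; exact zeroLocus_anti_mono (OrderDual.ofDual Q).2),
      (isClosed_zeroLocus _).preimage continuous_subtype_val⟩ :
      IrreducibleCloseds (zeroLocus k I))) ?_
  refine Monotone.strictMono_of_injective
    (fun Q R hQR x hx p hp => hx p (hQR hp)) fun Q R hQR => ?_
  have hsub (Q : PrimeSpectrum.zeroLocus (I : Set (MvPolynomial σ k))) :
      zeroLocus k Q.1.asIdeal ⊆ Set.range (Subtype.val : zeroLocus k I → σ → k) := by
    rw [Subtype.range_coe]; exact zeroLocus_anti_mono Q.2
  have h := congrArg IrreducibleCloseds.carrier hQR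
  have h' := (Set.preimage_eq_preimage' (hsub _) (hsub _)).1 h
  refine OrderDual.ofDual.injective (Subtype.ext (PrimeSpectrum.ext ?_))
  rw [← IsPrime.vanishingIdeal_zeroLocus (K := k) (OrderDual.ofDual Q).1.asIdeal, h',
    IsPrime.vanishingIdeal_zeroLocus]

end Zariski

section Height

variable {k : Type} [Field k] {σ : Type}

/-- The substitution killing the first `i` variables in the ordering given by `e`. -/
def killBelow {n : ℕ} (e : σ ≃ Fin n) (i : ℕ) : MvPolynomial σ k →ₐ[k] MvPolynomial σ k :=
  aeval fun j => if (e j : ℕ) < i then 0 else X j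

theorem natCard_le_height_ker_constantCoeff [Finite σ] :
    (Nat.card σ : ℕ∞) ≤ (RingHom.ker (constantCoeff (σ := σ) (R := k))).height := by
  obtain e := Finite.equivFin σ
  let Q (i : ℕ) : PrimeSpectrum (MvPolynomial σ k) :=
    ⟨RingHom.ker (killBelow (k := k) e i), RingHom.ker_isPrime _⟩
  have hQ (i : Fin (Nat.card σ)) : Q i < Q (i + 1) := by
    have hcomp (p : MvPolynomial σ k) :
        killBelow e (i + 1) (killBelow e i p) = killBelow e (i + 1) p := by
      rw [← AlgHom.comp_apply]
      congr 1
      ext j : 1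
      simp only [killBelow, AlgHom.comp_apply, aeval_X]
      split_ifs with h₁ h₂ h₂
      · simp
      · omega
      · rw [aeval_X, if_pos h₂]
      · rw [aeval_X, if_neg h₂]
    refine lt_of_le_not_ge (fun p hp => ?_) fun h => ?_
    · rw [RingHom.mem_ker] at hp ⊢
      rw [← hcomp, hp, map_zero]
    · have : X (e.symm i) ∈ RingHom.ker (killBelow (k := k) e i) :=
        h (by simp [Q, RingHom.mem_ker, killBelow])
      simp [RingHom.mem_ker, killBelow] at this
  let l : LTSeries (PrimeSpectrum (MvPolynomial σ k)) :=
    { length := Nat.card σ, toFun := fun i => Q i, step := fun i => by simpa using hQ i }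
  have hl : l.last = ⟨RingHom.ker (constantCoeff (σ := σ) (R := k)), RingHom.ker_isPrime _⟩ := by
    refine PrimeSpectrum.ext ?_
    have hconst : (killBelow (k := k) e (Nat.card σ)).toRingHom =
        C.comp constantCoeff := by
      ext j : 1
      · ext; simp [killBelow]
      · simp [killBelow]
    change RingHom.ker (killBelow (k := k) e (Nat.card σ)).toRingHom = _
    rw [hconst]
    exact RingHom.ker_comp_of_injective _ (C_injective σ k)
  have := Order.length_le_height_last (p := l)
  rw [hl, ← PrimeSpectrum.height_eq_orderHeight] at this
  exact this

theorem natCard_le_topologicalKrullDim_zeroLocus_pair_add_two [IsAlgClosed k] [Finite σ]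
    {f g : MvPolynomial σ k} (hf : constantCoeff f = 0) (hg : constantCoeff g = 0) :
    (Nat.card σ : WithBot ℕ∞) ≤ topologicalKrullDim (zeroLocus k (Ideal.span {f, g})) + 2 := by
  have hs : ({f, g} : Set (MvPolynomial σ k)) ⊆ RingHom.ker (constantCoeff (σ := σ) (R := k)) := by
    rintro _ (rfl | rfl)
    exacts [hf, hg]
  have := RingHom.ker_isPrime (constantCoeff (σ := σ) (R := k))
  have h₁ := Ideal.height_le_ringKrullDim_quotient_add_encard _ hs
  have h₂ : ((Nat.card σ : ℕ∞) : WithBot ℕ∞) ≤ _ :=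
    WithBot.coe_le_coe.2 (natCard_le_height_ker_constantCoeff (k := k) (σ := σ))
  refine (h₂.trans h₁).trans (add_le_add (ringKrullDim_quotient_le_topologicalKrullDim _) ?_)
  have h₃ : ({f, g} : Set (MvPolynomial σ k)).encard ≤ 2 :=
    (Set.encard_insert_le _ _).trans_eq (by rw [Set.encard_singleton, one_add_one_eq_two])
  exact WithBot.coe_le_coe.2 h₃

end Height

section Charts

variable {k : Type} [Field k]

theorem exists_eval_div_eq {σ τ : Type*} (n : τ → MvPolynomial σ k) (D : MvPolynomial σ k)
    (p : MvPolynomial τ k) : ∃ (q : MvPolynomial σ k) (N : ℕ), ∀ u : σ → k, eval u D ≠ 0 →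
      eval u q = eval u D ^ N * eval (fun a => eval u (n a) / eval u D) p := by
  induction p using MvPolynomial.induction_on with
  | C a => exact ⟨C a, 0, by simp⟩
  | add p₁ p₂ h₁ h₂ =>
    obtain ⟨q₁, N₁, h₁⟩ := h₁
    obtain ⟨q₂, N₂, h₂⟩ := h₂
    refine ⟨q₁ * D ^ N₂ + q₂ * D ^ N₁, N₁ + N₂, fun u hu => ?_⟩
    simp only [map_add, map_mul, map_pow, h₁ u hu, h₂ u hu]
    ring
  | mul_X p a h =>
    obtain ⟨q, N, h⟩ := h
    refine ⟨q * n a, N + 1, fun u hu => ?_⟩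
    simp only [map_mul, eval_X, h u hu]
    field_simp
    ring

variable (k) in
/-- The punctured affine cone over `ℙ² × ℙ⁹`. -/
abbrev Cone : Type :=
  {x : (Fin 3 ⊕ Fin 10) → k // (fun i => x (Sum.inl i)) ≠ 0 ∧ (fun j => x (Sum.inr j)) ≠ 0}

variable (k) in
/-- The product `ℙ² × ℙ⁹`. -/
abbrev Ambient : Type := Projectivization k (Fin 3 → k) × Projectivization k (Fin 10 → k)

/-- The projection from the punctured cone to `ℙ² × ℙ⁹`. -/
def coneMk (u : Cone k) : Ambient k :=
  (Projectivization.mk k (fun i => u.1 (Sum.inl i)) u.2.1,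
    Projectivization.mk k (fun j => u.1 (Sum.inr j)) u.2.2)

theorem isOpen_iff_coneMk_preimage {U : Set (Ambient k)} : IsOpen U ↔ IsOpen (coneMk ⁻¹' U) :=
  isOpen_coinduced

theorem isClosed_iff_coneMk_preimage {Z : Set (Ambient k)} :
    IsClosed Z ↔ IsClosed (coneMk ⁻¹' Z) :=
  isClosed_coinduced

theorem continuous_coneMk : Continuous (coneMk (k := k)) :=
  continuous_coinduced_rng

theorem coneMk_eq_coneMk_iff {u u' : Cone k} : coneMk u = coneMk u' ↔
    ∃ a b : k, (∀ i, a * u'.1 (Sum.inl i) = u.1 (Sum.inl i)) ∧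
      ∀ j, b * u'.1 (Sum.inr j) = u.1 (Sum.inr j) := by
  simp only [coneMk, Prod.mk.injEq, Projectivization.mk_eq_mk_iff', funext_iff, Pi.smul_apply,
    smul_eq_mul, exists_and_left, exists_and_right]

theorem coneMk_surjective : Function.Surjective (coneMk (k := k)) := by
  rintro ⟨x, y⟩
  induction x with | h v hv
  induction y with | h w hw
  exact ⟨⟨Sum.elim v w, hv, hw⟩, rfl⟩

/-- The affine parametrization of the part of the cone where the `i`-th coordinate of `ℙ²` and
the `j`-th coordinate of `ℙ⁹` are both `1`. -/
def chartLift (i : Fin 3) (j : Fin 10) (y : Fin 2 ⊕ Fin 9 → k) : Cone k :=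
  ⟨Sum.elim (i.insertNth (1 : k) fun a => y (Sum.inl a))
      (j.insertNth (1 : k) fun b => y (Sum.inr b)),
    fun h => by simpa using congrFun h i, fun h => by simpa using congrFun h j⟩

/-- The coordinates of `chartLift` as polynomials. -/
def chartPoly (i : Fin 3) (j : Fin 10) : Fin 3 ⊕ Fin 10 → MvPolynomial (Fin 2 ⊕ Fin 9) k :=
  Sum.elim (i.insertNth (1 : MvPolynomial (Fin 2 ⊕ Fin 9) k) fun a => X (Sum.inl a))
    (j.insertNth (1 : MvPolynomial (Fin 2 ⊕ Fin 9) k) fun b => X (Sum.inr b))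

theorem eval_chartPoly (i : Fin 3) (j : Fin 10) (y : Fin 2 ⊕ Fin 9 → k) :
    (fun c => eval y (chartPoly i j c)) = (chartLift i j y).1 := by
  ext c
  rcases c with c | c
  · refine Fin.succAboveCases i ?_ (fun a => ?_) c <;> simp [chartPoly, chartLift]
  · refine Fin.succAboveCases j ?_ (fun a => ?_) c <;> simp [chartPoly, chartLift]

theorem continuous_chartLift (i : Fin 3) (j : Fin 10) :
    Continuous (chartLift (k := k) i j) := by
  refine Continuous.subtype_mk (continuous_of_polynomial fun p => ?_) _
  convert isOpen_ne_zero (aeval (chartPoly i j) p) using 4 with y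
  rw [eval_aeval_eq, eval_chartPoly]
  rfl

/-- The standard affine charts of `ℙ² × ℙ⁹`. -/
def chart (i : Fin 3) (j : Fin 10) (y : Fin 2 ⊕ Fin 9 → k) : Ambient k :=
  coneMk (chartLift i j y)

theorem continuous_chart (i : Fin 3) (j : Fin 10) : Continuous (chart (k := k) i j) :=
  continuous_coneMk.comp (continuous_chartLift i j)

/-- The affine coordinates of a point of the cone. -/
def chartCoord (i : Fin 3) (j : Fin 10) (u : Cone k) : Fin 2 ⊕ Fin 9 → k :=
  Sum.elim (fun a => u.1 (Sum.inl (i.succAbove a)) / u.1 (Sum.inl i))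
    (fun b => u.1 (Sum.inr (j.succAbove b)) / u.1 (Sum.inr j))

theorem chart_eq_coneMk_iff {i : Fin 3} {j : Fin 10} {y : Fin 2 ⊕ Fin 9 → k} {u : Cone k} :
    coneMk u = chart i j y ↔
      (u.1 (Sum.inl i) ≠ 0 ∧ u.1 (Sum.inr j) ≠ 0) ∧ chartCoord i j u = y := by
  rw [chart, coneMk_eq_coneMk_iff]
  constructor
  · rintro ⟨a, b, ha, hb⟩
    have ha' : a = u.1 (Sum.inl i) := by simpa [chartLift] using ha i
    have hb' : b = u.1 (Sum.inr j) := by simpa [chartLift] using hb j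
    have h₁ : u.1 (Sum.inl i) ≠ 0 := fun h => u.2.1 (by
      ext c
      simp [← ha c, ha', h])
    have h₂ : u.1 (Sum.inr j) ≠ 0 := fun h => u.2.2 (by
      ext c
      simp [← hb c, hb', h])
    refine ⟨⟨h₁, h₂⟩, ?_⟩
    ext c
    rcases c with c | c
    · simp [chartCoord, ← ha (i.succAbove c), ha', chartLift, h₁]
    · simp [chartCoord, ← hb (j.succAbove c), hb', chartLift, h₂]
  · rintro ⟨⟨h₁, h₂⟩, rfl⟩
    refine ⟨u.1 (Sum.inl i), u.1 (Sum.inr j), fun c => ?_, fun c => ?_⟩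
    · refine Fin.succAboveCases i ?_ (fun a => ?_) c
      · simp [chartLift]
      · simp [chartLift, chartCoord, mul_div_cancel₀, h₁]
    · refine Fin.succAboveCases j ?_ (fun a => ?_) c
      · simp [chartLift]
      · simp [chartLift, chartCoord, mul_div_cancel₀, h₂]

theorem chart_injective (i : Fin 3) (j : Fin 10) : Function.Injective (chart (k := k) i j) := by
  intro y y' h
  exact (chart_eq_coneMk_iff.1 (rfl : coneMk (chartLift i j y) = chart i j y)).2.symm.trans
    (chart_eq_coneMk_iff.1 (h : coneMk (chartLift i j y) = chart i j y')).2

theorem isOpenMap_chart (i : Fin 3) (j : Fin 10) : IsOpenMap (chart (k := k) i j) := by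
  rw [isTopologicalBasis_zariski.isOpenMap_iff]
  rintro _ ⟨p, rfl⟩
  rw [isOpen_iff_coneMk_preimage]
  let n : Fin 2 ⊕ Fin 9 → MvPolynomial (Fin 3 ⊕ Fin 10) k :=
    Sum.elim (fun a => X (Sum.inl (i.succAbove a)) * X (Sum.inr j))
      (fun b => X (Sum.inr (j.succAbove b)) * X (Sum.inl i))
  obtain ⟨q, N, hq⟩ := exists_eval_div_eq n (X (Sum.inl i) * X (Sum.inr j)) p
  convert (isOpen_ne_zero (X (Sum.inl i) * X (Sum.inr j) * q)).preimage
    (continuous_subtype_val : Continuous (Subtype.val : Cone k → _))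
  ext u
  have hu : (u.1 (Sum.inl i) ≠ 0 ∧ u.1 (Sum.inr j) ≠ 0) →
      (fun a => eval u.1 (n a) / eval u.1 (X (Sum.inl i) * X (Sum.inr j))) =
        chartCoord i j u := by
    rintro ⟨h₁, h₂⟩
    ext a
    rcases a with a | a
    · simp [n, chartCoord, mul_div_mul_right, h₂]
    · simp only [n, chartCoord, Sum.elim_inr, map_mul, eval_X]
      field_simp
  simp only [Set.mem_preimage, Set.mem_image, Set.mem_ofPred_eq, map_mul, eval_X]
  constructor
  · rintro ⟨y, hy, hyu⟩
    obtain ⟨⟨h₁, h₂⟩, rfl⟩ := chart_eq_coneMk_iff.1 hyu.symm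
    rw [hq _ (by simp [h₁, h₂]), hu ⟨h₁, h₂⟩]
    simp [h₁, h₂, hy]
  · intro h
    have h₁ : u.1 (Sum.inl i) ≠ 0 := fun h' => h (by simp [h'])
    have h₂ : u.1 (Sum.inr j) ≠ 0 := fun h' => h (by simp [h'])
    rw [hq _ (by simp [h₁, h₂]), hu ⟨h₁, h₂⟩] at h
    exact ⟨_, fun h' => h (by simp [h']), (chart_eq_coneMk_iff.2 ⟨⟨h₁, h₂⟩, rfl⟩).symm⟩

theorem isOpenEmbedding_chart (i : Fin 3) (j : Fin 10) : IsOpenEmbedding (chart (k := k) i j) :=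
  .of_continuous_injective_isOpenMap (continuous_chart i j) (chart_injective i j)
    (isOpenMap_chart i j)

theorem exists_chart_eq (x : Ambient k) : ∃ i j y, chart i j y = x := by
  obtain ⟨u, rfl⟩ := coneMk_surjective x
  obtain ⟨i, hi⟩ := Function.ne_iff.1 u.2.1
  obtain ⟨j, hj⟩ := Function.ne_iff.1 u.2.2
  exact ⟨i, j, _, (chart_eq_coneMk_iff.2 ⟨⟨hi, hj⟩, rfl⟩).symm⟩

theorem topologicalKrullDim_ambient_le :
    topologicalKrullDim (Ambient k) ≤ (11 : ℕ∞) := by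
  rw [topologicalKrullDim, krullDim_eq_iSup_coheight]
  refine iSup_le fun Z => ?_
  obtain ⟨x, hx⟩ := Z.isIrreducible.nonempty
  obtain ⟨i, j, y, rfl⟩ := exists_chart_eq x
  have hopen := isOpenEmbedding_chart (k := k) i j
  obtain ⟨W, hW⟩ := (IrreducibleCloseds.orderIsoOfIsOpenEmbedding _ hopen).surjective
    ⟨Z, ⟨y, hx⟩⟩
  have hWZ : IrreducibleCloseds.map _ hopen.continuous W = Z := congrArg Subtype.val hW
  rw [← hWZ, hopen.coheight_map]
  refine (coheight_le_krullDim W).trans (topologicalKrullDim_affine_le.trans_eq ?_)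
  simp

end Charts

section Dimension

variable {k : Type} [Field k]

theorem isOpenEmbedding_cone :
    IsOpenEmbedding (Subtype.val : Cone k → (Fin 3 ⊕ Fin 10) → k) := by
  refine IsOpen.isOpenEmbedding_subtypeVal ?_
  have : {x : (Fin 3 ⊕ Fin 10) → k |
      (fun i => x (Sum.inl i)) ≠ 0 ∧ (fun j => x (Sum.inr j)) ≠ 0} =
      (⋃ i, {x | eval x (X (Sum.inl i) : MvPolynomial (Fin 3 ⊕ Fin 10) k) ≠ 0}) ∩
        ⋃ j, {x | eval x (X (Sum.inr j) : MvPolynomial (Fin 3 ⊕ Fin 10) k) ≠ 0} := by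
    ext x
    simp [Function.ne_iff]
  change IsOpen {x : (Fin 3 ⊕ Fin 10) → k |
    (fun i => x (Sum.inl i)) ≠ 0 ∧ (fun j => x (Sum.inr j)) ≠ 0}
  rw [this]
  exact (isOpen_iUnion fun _ => isOpen_ne_zero _).inter
    (isOpen_iUnion fun _ => isOpen_ne_zero _)

theorem isIrreducible_coneMk_image [IsAlgClosed k] (I : Ideal (MvPolynomial (Fin 3 ⊕ Fin 10) k))
    [I.IsPrime] {u : Cone k} (hu : u.1 ∈ zeroLocus k I) :
    IsIrreducible (coneMk '' (Subtype.val ⁻¹' zeroLocus k I)) :=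
  ((isIrreducible_zeroLocus I).preimage isOpenEmbedding_cone ⟨u.1, hu, u, rfl⟩).image _
    continuous_coneMk.continuousOn

theorem eval_eq_zero_iff_of_coneMk_eq {g : MvPolynomial (Fin 3 ⊕ Fin 10) k}
    (hg : IsBiHomogeneous k g) {u u' : Cone k} (h : coneMk u = coneMk u') :
    eval u.1 g = 0 ↔ eval u'.1 g = 0 := by
  have := eval_eq_zero_iff_of_mk_eq hg u.2.1 u'.2.1 u.2.2 u'.2.2 (congrArg Prod.fst h)
    (congrArg Prod.snd h)
  have helim (u : Cone k) :
      Sum.elim (fun i => u.1 (Sum.inl i)) (fun j => u.1 (Sum.inr j)) = u.1 :=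
    Sum.elim_comp_inl_inr u.1
  rwa [helim, helim] at this

theorem coneMk_mem_flex_iff {u : Cone k} :
    coneMk u ∈ Flex k ↔ eval u.1 (fpoly k) = 0 ∧ eval u.1 (hpoly k) = 0 := by
  have := mk_mem_flex_iff u.2.1 u.2.2
  rwa [show Sum.elim (fun i => u.1 (Sum.inl i)) (fun j => u.1 (Sum.inr j)) = u.1 from
    Sum.elim_comp_inl_inr u.1] at this

theorem isClosed_flex : IsClosed (Flex k) := by
  rw [isClosed_iff_coneMk_preimage]
  have : coneMk ⁻¹' Flex k = (Subtype.val : Cone k → _) ⁻¹'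
      ({x | eval x (fpoly k) = 0} ∩ {x | eval x (hpoly k) = 0}) := by
    ext u
    exact coneMk_mem_flex_iff
  rw [this]
  exact ((isClosed_eq_zero _).inter (isClosed_eq_zero _)).preimage continuous_subtype_val

theorem chartLift_zero_one_zero : (chartLift (k := k) 0 1 0).1 =
    Sum.elim ![1, 0, 0] ![0, 1, 0, 0, 0, 0, 0, 0, 0, 0] := by
  ext c
  rcases c with c | c <;> fin_cases c <;> rfl

theorem coneMk_chartLift_zero_mem_flex : coneMk (chartLift (k := k) 0 1 0) ∈ Flex k := by
  rw [coneMk_mem_flex_iff, chartLift_zero_one_zero, hpoly_eq, Matrix.det_fin_three, fpoly_eq]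
  simp [hessian, halfDeriv₁₁, halfDeriv₂₂, deriv₁₂]

variable (k) in
/-- The universal cubic curve `{f = 0}` in `ℙ² × ℙ⁹`. -/
def universalCubic : Set (Ambient k) := coneMk '' {u | eval u.1 (fpoly k) = 0}

theorem coneMk_mem_universalCubic_iff {u : Cone k} :
    coneMk u ∈ universalCubic k ↔ eval u.1 (fpoly k) = 0 := by
  refine ⟨?_, fun h => ⟨u, h, rfl⟩⟩
  rintro ⟨u', hu', h⟩
  exact (eval_eq_zero_iff_of_coneMk_eq (isBiHomogeneous_fpoly k) h).1 hu'

theorem isClosed_universalCubic : IsClosed (universalCubic k) := by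
  rw [isClosed_iff_coneMk_preimage]
  have : coneMk ⁻¹' universalCubic k = (Subtype.val : Cone k → _) ⁻¹'
      {x | eval x (fpoly k) = 0} := by
    ext u
    exact coneMk_mem_universalCubic_iff
  rw [this]
  exact (isClosed_eq_zero _).preimage continuous_subtype_val

theorem flex_subset_universalCubic : Flex k ⊆ universalCubic k := by
  intro x hx
  obtain ⟨u, rfl⟩ := coneMk_surjective x
  exact coneMk_mem_universalCubic_iff.2 (coneMk_mem_flex_iff.1 hx).1

theorem isIrreducible_universalCubic [IsAlgClosed k] : IsIrreducible (universalCubic k) := by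
  have := (Ideal.span_singleton_prime (prime_fpoly k).ne_zero).2 (prime_fpoly k)
  have hlocus : zeroLocus k (Ideal.span {fpoly k}) = {x | eval x (fpoly k) = 0} := by
    rw [zeroLocus_span]
    ext x
    simp only [Set.mem_singleton_iff, forall_eq]
    rfl
  have h := isIrreducible_coneMk_image (Ideal.span {fpoly k}) (u := chartLift 0 1 0) (by
    rw [hlocus]
    exact (coneMk_mem_flex_iff.1 coneMk_chartLift_zero_mem_flex).1)
  rwa [hlocus] at h

theorem not_universalCubic_subset_flex [CharZero k] : ¬ universalCubic k ⊆ Flex k := by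
  intro h
  let u : Cone k := ⟨Sum.elim ![0, 1, 0] ![0, 0, 0, 0, 0, 1, 0, 0, 1, 0],
    fun h => by simpa using congrFun h 1, fun h => by simpa using congrFun h 5⟩
  have hu : coneMk u ∈ universalCubic k := by
    rw [coneMk_mem_universalCubic_iff, fpoly_eq]
    simp [u]
  have := (coneMk_mem_flex_iff.1 (h hu)).2
  rw [hpoly_eq, Matrix.det_fin_three] at this
  simp [u, hessian, halfDeriv₁₁, halfDeriv₂₂, deriv₁₂] at this

theorem universalCubic_ne_univ : universalCubic k ≠ Set.univ := by
  intro h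
  let u : Cone k := ⟨Sum.elim ![0, 1, 0] 1,
    fun h => by simpa using congrFun h 1, fun h => by simpa using congrFun h 5⟩
  have hu := coneMk_mem_universalCubic_iff.1 (h ▸ Set.mem_univ (coneMk u))
  rw [fpoly_eq] at hu
  simp [u] at hu

variable (k) in
theorem isIrreducible_univ_ambient [IsAlgClosed k] : IsIrreducible (Set.univ : Set (Ambient k)) := by
  have h := isIrreducible_coneMk_image (⊥ : Ideal (MvPolynomial (Fin 3 ⊕ Fin 10) k))
    (u := chartLift 0 0 0) (by simp)
  simpa [coneMk_surjective.range_eq] using h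

theorem topologicalKrullDim_flex_add_two_le [IsAlgClosed k] [CharZero k] :
    topologicalKrullDim (Flex k) + 2 ≤ topologicalKrullDim (Ambient k) := by
  rcases isEmpty_or_nonempty (IrreducibleCloseds (Flex k)) with hempty | hnonempty
  · rw [topologicalKrullDim, krullDim_eq_bot, WithBot.bot_add]
    exact bot_le
  let j (Z : IrreducibleCloseds (Flex k)) : IrreducibleCloseds (Ambient k) :=
    Z.map _ continuous_subtype_val
  let V : IrreducibleCloseds (Ambient k) :=
    ⟨universalCubic k, isIrreducible_universalCubic, isClosed_universalCubic⟩
  let T : IrreducibleCloseds (Ambient k) :=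
    ⟨Set.univ, isIrreducible_univ_ambient k, isClosed_univ⟩
  have hjV (Z : IrreducibleCloseds (Flex k)) : j Z < V := by
    have hjF : (j Z : Set (Ambient k)) ⊆ Flex k :=
      closure_minimal (Subtype.coe_image_subset _ _) isClosed_flex
    exact ⟨hjF.trans flex_subset_universalCubic,
      fun h => not_universalCubic_subset_flex (Set.Subset.trans h hjF)⟩
  have hVT : V < T := Set.ssubset_univ_iff.2 universalCubic_ne_univ
  rw [topologicalKrullDim, topologicalKrullDim, ← one_add_one_eq_two, ← add_assoc,
    ← krullDim_WithTop, ← krullDim_WithTop]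
  let jV (z : WithTop (IrreducibleCloseds (Flex k))) : IrreducibleCloseds (Ambient k) :=
    z.recTopCoe V j
  have hjV' : StrictMono jV := WithTop.strictMono_iff.2
    ⟨IrreducibleCloseds.map_strictMono_of_isInducing IsInducing.subtypeVal, hjV⟩
  refine krullDim_le_of_strictMono
    (fun z : WithTop (WithTop (IrreducibleCloseds (Flex k))) => z.recTopCoe T jV)
    (WithTop.strictMono_iff.2 ⟨hjV', fun z => ?_⟩)
  induction z with
  | top => exact hVT
  | coe Z => exact (hjV Z).trans hVT

theorem eleven_le_topologicalKrullDim_flex_add_two [IsAlgClosed k] :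
    (11 : WithBot ℕ∞) ≤ topologicalKrullDim (Flex k) + 2 := by
  have heval (y : Fin 2 ⊕ Fin 9 → k) (p) :
      eval y (aeval (chartPoly (k := k) 0 1) p) = eval (chartLift 0 1 y).1 p := by
    rw [eval_aeval_eq, eval_chartPoly]
  have h₀ := coneMk_mem_flex_iff.1 (coneMk_chartLift_zero_mem_flex (k := k))
  let I := Ideal.span {aeval (chartPoly (k := k) 0 1) (fpoly k),
    aeval (chartPoly (k := k) 0 1) (hpoly k)}
  have hI (y : zeroLocus k I) : chart 0 1 y.1 ∈ Flex k :=
    coneMk_mem_flex_iff.2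
      ⟨(heval _ _).symm.trans (y.2 _ (Ideal.subset_span (by simp))),
        (heval _ _).symm.trans (y.2 _ (Ideal.subset_span (by simp)))⟩
  have hind : IsInducing fun y : zeroLocus k I => (⟨chart 0 1 y.1, hI y⟩ : Flex k) :=
    IsInducing.subtypeVal.of_comp_iff.1
      ((isOpenEmbedding_chart 0 1).isInducing.comp IsInducing.subtypeVal)
  have h := natCard_le_topologicalKrullDim_zeroLocus_pair_add_two
    (f := aeval (chartPoly (k := k) 0 1) (fpoly k))
    (g := aeval (chartPoly (k := k) 0 1) (hpoly k))
    (by rw [← eval_zero, heval]; exact h₀.1) (by rw [← eval_zero, heval]; exact h₀.2)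
  refine le_trans ?_ (h.trans (add_le_add_left hind.topologicalKrullDim_le 2))
  simp

theorem topologicalKrullDim_ambient_and_flex [IsAlgClosed k] [CharZero k] :
    topologicalKrullDim (Ambient k) = (11 : ℕ∞) ∧ topologicalKrullDim (Flex k) = (9 : ℕ∞) := by
  have h₁ := eleven_le_topologicalKrullDim_flex_add_two (k := k)
  have h₂ := topologicalKrullDim_flex_add_two_le (k := k)
  have h₃ := topologicalKrullDim_ambient_le (k := k)
  refine ⟨le_antisymm h₃ (h₁.trans h₂), ?_⟩
  replace h₂ := h₂.trans h₃
  generalize topologicalKrullDim (Flex k) = d at h₁ h₂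
  induction d using WithBot.recBotCoe with
  | bot => simp at h₁
  | coe d =>
    induction d using ENat.recTopCoe with
    | top => exact absurd h₂ (by decide)
    | coe d =>
      have h₁' : ((11 : ℕ) : WithBot ℕ∞) ≤ ((d + 2 : ℕ) : WithBot ℕ∞) := by
        rw [Nat.cast_add]; exact h₁
      have h₂' : ((d + 2 : ℕ) : WithBot ℕ∞) ≤ ((11 : ℕ) : WithBot ℕ∞) := by
        rw [Nat.cast_add]; exact h₂
      obtain rfl : d = 9 := by
        have := Nat.cast_le.1 h₁'
        have := Nat.cast_le.1 h₂'
        omega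
      rfl

end Dimension

end FlexVariety

/-- **Corollary.** The variety of flexes `F` is an ideal theoretic complete intersection
of codimension `2` in `ℙ(L) × ℙ(Φ) ≅ ℙ² × ℙ⁹`: the ambient space has dimension `11`,
`F` has dimension `9`, and the bi-homogeneous ideal of `F` is generated by the
`2 = codim F` elements `f` and `h`. -/
theorem flex_is_ideal_theoretic_complete_intersection [IsAlgClosed k] [CharZero k] :
    topologicalKrullDim
        (Projectivization k (Fin 3 → k) × Projectivization k (Fin 10 → k)) = (11 : ℕ∞) ∧
    topologicalKrullDim (Flex k) = (9 : ℕ∞) ∧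
    flexIdeal k = Ideal.span {fpoly k, hpoly k} := by
  exact ⟨FlexVariety.topologicalKrullDim_ambient_and_flex.1,
    FlexVariety.topologicalKrullDim_ambient_and_flex.2, FlexVariety.flexIdeal_eq⟩

end
end

section
/- Let φ: X → Y be a morphism of algebraic varieties over k and let d, n be positive integers such that: (a) Y is irreducible with dim Y = n; (b) dim φ^{-1}(y) = d for every y ∈ Y; (c) φ^{-1}(y) is irreducible for every y in a dense open subset of Y; (d) every irreducible component of X has dimension at least n + d. Then X is irreducible. -/
open AlgebraicGeometry CategoryTheory

theorem MvPolynomial.height_eq_of_isMaximal {k : Type*} [Field k] (n : ℕ)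
    (P : Ideal (MvPolynomial (Fin n) k)) [hP : P.IsMaximal] : P.height = n := by
  induction n with
  | zero =>
    have h := Ideal.height_le_ringKrullDim_of_ne_top hP.ne_top
    simp at h
    simpa using h
  | succ n ih =>
    let e := (MvPolynomial.finSuccEquiv k n).toRingEquiv
    let P' : Ideal (Polynomial (MvPolynomial (Fin n) k)) := P.map e
    have : P'.IsMaximal := Ideal.map_isMaximal_of_equiv e
    have hmax : (P'.under (MvPolynomial (Fin n) k)).IsMaximal :=
      Polynomial.isMaximal_comap_C_of_isJacobsonRing P'
    rw [← e.height_map P]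
    change P'.height = _
    have : P'.LiesOver (P'.under (MvPolynomial (Fin n) k)) := ⟨rfl⟩
    rw [Polynomial.height_eq_height_add_one (P'.under (MvPolynomial (Fin n) k)) P', ih]
    simp

theorem Ideal.height_map_quotientMk_eq_zero_of_isIntegral {R S : Type*} [CommRing R] [CommRing S]
    [Algebra R S] [Algebra.IsIntegral R S] (p : Ideal R) [p.IsMaximal] (P : Ideal S) [P.IsPrime]
    [P.LiesOver p] :
    (P.map (Ideal.Quotient.mk (p.map (algebraMap R S)))).height = 0 := by
  have : Ring.KrullDimLE 0 (S ⧸ p.map (algebraMap R S)) := by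
    refine .mk₀ fun I _ ↦ ?_
    let J := I.comap (Ideal.Quotient.mk (p.map (algebraMap R S)))
    have hpJ : p.map (algebraMap R S) ≤ J := by
      simpa [J] using Ideal.ker_le_comap (Ideal.Quotient.mk (p.map (algebraMap R S))) (K := I)
    have hp : p = J.comap (algebraMap R S) :=
      Ideal.IsMaximal.eq_of_le ‹_› Ideal.IsPrime.ne_top' (Ideal.map_le_iff_le_comap.mp hpJ)
    have : J.IsMaximal := Ideal.isMaximal_of_isIntegral_of_isMaximal_comap (R := R) J (hp ▸ ‹_›)
    have := Ideal.map_eq_top_or_isMaximal_of_surjective (Ideal.Quotient.mk (p.map (algebraMap R S)))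
      Ideal.Quotient.mk_surjective this
    rw [Ideal.map_comap_of_surjective _ Ideal.Quotient.mk_surjective] at this
    exact this.resolve_left Ideal.IsPrime.ne_top'
  have hle : p.map (algebraMap R S) ≤ P := Ideal.map_le_iff_le_comap.mpr (P.over_def p).le
  have : (P.map (Ideal.Quotient.mk (p.map (algebraMap R S)))).IsPrime :=
    Ideal.map_isPrime_of_surjective Ideal.Quotient.mk_surjective (by rwa [Ideal.mk_ker])
  rw [Ideal.height_eq_zero_iff]
  exact Ideal.mem_minimalPrimes_of_krullDimLE_zero _

theorem height_eq_ringKrullDim_of_isMaximal (k : Type*) {B : Type*} [Field k] [CommRing B]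
    [IsDomain B] [Algebra k B] [Algebra.FiniteType k B] (Q : Ideal B) [Q.IsMaximal] :
    Q.height = ringKrullDim B := by
  obtain ⟨s, g, hg, hfin⟩ := exists_integral_inj_algHom_of_fg k B
  algebraize [g.toRingHom]
  have : FaithfulSMul (MvPolynomial (Fin s) k) B := (faithfulSMul_iff_algebraMap_injective _ _).mpr hg
  have : Algebra.IsIntegral (MvPolynomial (Fin s) k) B := ⟨hfin⟩
  have : IsNoetherianRing B := Algebra.FiniteType.isNoetherianRing k B
  have key (Q : Ideal B) [Q.IsMaximal] : Q.height = s := by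
    have : (Q.under (MvPolynomial (Fin s) k)).IsMaximal :=
      Ideal.isMaximal_comap_of_isIntegral_of_isMaximal Q
    rw [Ideal.height_eq_height_add_of_liesOver_of_hasGoingDown (Q.under (MvPolynomial (Fin s) k)) Q,
      Ideal.height_map_quotientMk_eq_zero_of_isIntegral, MvPolynomial.height_eq_of_isMaximal,
      add_zero]
  rw [key Q]
  apply le_antisymm
  · rw [← key Q]
    exact Ideal.height_le_ringKrullDim_of_ne_top Ideal.IsPrime.ne_top'
  · rw [ringKrullDim_le_iff_isMaximal_height_le]
    intro M hM
    rw [key M]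

theorem ringKrullDim_le_add_ringKrullDim_fiber (k : Type*) {A B : Type*} [Field k] [CommRing A]
    [IsNoetherianRing A] [CommRing B] [IsDomain B] [Algebra k B] [Algebra.FiniteType k B] [Algebra A B]
    (Q : Ideal B) [Q.IsMaximal] (P : Ideal A) [P.IsPrime] [Q.LiesOver P] :
    ringKrullDim B ≤ ringKrullDim A + ringKrullDim (B ⧸ P.map (algebraMap A B)) := by
  have : IsNoetherianRing B := Algebra.FiniteType.isNoetherianRing k B
  have hle : P.map (algebraMap A B) ≤ Q := Ideal.map_le_iff_le_comap.mpr (Q.over_def P).le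
  have : (Q.map (Ideal.Quotient.mk (P.map (algebraMap A B)))).IsMaximal :=
    .map_of_surjective_of_ker_le Ideal.Quotient.mk_surjective (by rwa [Ideal.mk_ker])
  rw [← height_eq_ringKrullDim_of_isMaximal k Q]
  refine (WithBot.coe_le_coe.mpr (Ideal.height_le_height_add_of_liesOver P Q)).trans ?_
  rw [WithBot.coe_add]
  gcongr
  · exact Ideal.height_le_ringKrullDim_of_ne_top Ideal.IsPrime.ne_top'
  · exact Ideal.height_le_ringKrullDim_of_ne_top Ideal.IsPrime.ne_top'

theorem Topology.IsConstructible.exists_isOpen_subset_or_subset_compl {T : Type*}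
    [TopologicalSpace T] [IrreducibleSpace T] {s : Set T} (hs : IsConstructible s) :
    ∃ U : Set T, IsOpen U ∧ U.Nonempty ∧ (U ⊆ s ∨ U ⊆ sᶜ) := by
  induction hs using IsConstructible.empty_union_induction with
  | open_retrocompact U hU _ =>
    rcases U.eq_empty_or_nonempty with rfl | h
    · exact ⟨Set.univ, isOpen_univ, Set.univ_nonempty, by simp⟩
    · exact ⟨U, hU, h, .inl subset_rfl⟩
  | union s hs t ht h₁ h₂ =>
    obtain ⟨U, hU, hU', h | h⟩ := h₁
    · exact ⟨U, hU, hU', .inl (h.trans Set.subset_union_left)⟩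
    obtain ⟨V, hV, hV', h' | h'⟩ := h₂
    · exact ⟨V, hV, hV', .inl (h'.trans Set.subset_union_right)⟩
    · refine ⟨U ∩ V, hU.inter hV, nonempty_preirreducible_inter hU hV hU' hV', .inr ?_⟩
      rw [Set.compl_union]
      exact Set.inter_subset_inter h h'
  | compl s hs h =>
    obtain ⟨U, hU, hU', h⟩ := h
    exact ⟨U, hU, hU', by rw [compl_compl]; exact h.symm⟩

theorem PrimeSpectrum.exists_isOpen_subset_range_comap {A B : Type*} [CommRing A]
    [IsDomain A] [IsNoetherianRing A] [CommRing B] (f : A →+* B) (hf : f.FiniteType)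
    (hinj : Function.Injective f) :
    ∃ U : Set (PrimeSpectrum A), IsOpen U ∧ U.Nonempty ∧ U ⊆ Set.range (comap f) := by
  have hfp : f.FinitePresentation := RingHom.FinitePresentation.of_finiteType.mp hf
  obtain ⟨U, hU, hU', h | h⟩ :=
    (isConstructible_range_comap hfp).exists_isOpen_subset_or_subset_compl
  · exact ⟨U, hU, hU', h⟩
  · obtain ⟨x, hx, hxU⟩ := (denseRange_comap_iff_ker_le_nilRadical f).mpr (by
      rw [(RingHom.injective_iff_ker_eq_bot f).mp hinj]; exact bot_le) |>.inter_open_nonempty U hU hU'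
    exact (h hx hxU).elim

theorem Ideal.isMaximal_comap_of_finiteType {A B : Type*} [CommRing A] [IsJacobsonRing A]
    [CommRing B] (f : A →+* B) (hf : f.FiniteType) (Q : Ideal B) [Q.IsMaximal] :
    (Q.comap f).IsMaximal := by
  algebraize [f]
  let _ : Field (B ⧸ Q) := Ideal.Quotient.field Q
  have : Algebra.FiniteType A (B ⧸ Q) :=
    .of_surjective (IsScalarTower.toAlgHom A B (B ⧸ Q)) Ideal.Quotient.mk_surjective
  have : Module.Finite A (B ⧸ Q) := finite_of_finite_type_of_isJacobsonRing A (B ⧸ Q)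
  have := Ideal.isMaximal_comap_of_isIntegral_of_isMaximal (R := A) (⊥ : Ideal (B ⧸ Q))
  rwa [IsScalarTower.algebraMap_eq A B (B ⧸ Q), ← Ideal.comap_comap,
    Ideal.Quotient.algebraMap_eq, ← RingHom.ker_eq_comap_bot, Ideal.mk_ker] at this

theorem RingHom.injective_of_add_le_ringKrullDim (k : Type*) {A B : Type*} [Field k] [CommRing A]
    [CommRing B] [IsDomain A] [IsDomain B] [Algebra k A] [Algebra.FiniteType k A] [Algebra k B]
    [Algebra.FiniteType k B] (f : A →+* B) (n d : ℕ) (hA : ringKrullDim A ≤ n)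
    (hB : ((n + d : ℕ) : WithBot ℕ∞) ≤ ringKrullDim B) (Q : Ideal B) [Q.IsMaximal]
    (hQ : ringKrullDim (B ⧸ (Q.comap f).map f) ≤ d) : Function.Injective f := by
  have : IsNoetherianRing A := Algebra.FiniteType.isNoetherianRing k A
  rw [injective_iff_map_eq_zero]
  by_contra! H
  obtain ⟨r, hr, hr0⟩ := H
  have hlt := ringKrullDim_succ_le_of_surjective (Ideal.Quotient.mk (RingHom.ker f))
    Ideal.Quotient.mk_surjective (mem_nonZeroDivisors_of_ne_zero hr0)
    (Ideal.Quotient.eq_zero_iff_mem.mpr hr)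
  let g : A ⧸ RingHom.ker f →+* B := RingHom.kerLift f
  have hg : g.comp (Ideal.Quotient.mk (RingHom.ker f)) = f := by
    ext; simp [g]
  let _ : Algebra (A ⧸ RingHom.ker f) B := g.toAlgebra
  have hQg : (Q.comap f).map f = (Q.comap g).map g := by
    conv_lhs => rw [← hg]
    rw [← Ideal.comap_comap, ← Ideal.map_map,
      Ideal.map_comap_of_surjective _ Ideal.Quotient.mk_surjective]
  have : Q.LiesOver (Q.comap g) := ⟨rfl⟩
  have hle := ringKrullDim_le_add_ringKrullDim_fiber k Q (Q.comap g)
  change _ ≤ _ + ringKrullDim (B ⧸ (Q.comap g).map g) at hle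
  rw [← hQg] at hle
  replace hle := hB.trans (hle.trans (add_le_add_right hQ _))
  replace hlt := hlt.trans hA
  generalize ringKrullDim (A ⧸ RingHom.ker f) = a at hle hlt
  induction a with
  | bot => simp at hle
  | coe a =>
    induction a with
    | top => 
      change ((⊤ + 1 : ℕ∞) : WithBot ℕ∞) ≤ ((n : ℕ∞) : WithBot ℕ∞) at hlt
      rw [WithBot.coe_le_coe, top_add, top_le_iff] at hlt
      exact absurd hlt (ENat.natCast_ne_top n)
    | coe a =>
      norm_cast at hle hlt
      lia

theorem PrimeSpectrum.exists_isOpen_forall_le_ringKrullDim_fiber (k : Type*) {A B : Type*}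
    [Field k] [CommRing A] [CommRing B] [IsDomain A] [IsDomain B] [Algebra k A]
    [Algebra.FiniteType k A] (f : A →+* B) (hf : f.FiniteType) (n d : ℕ)
    (hA : ringKrullDim A ≤ n) (hB : ((n + d : ℕ) : WithBot ℕ∞) ≤ ringKrullDim B)
    (hfib : ∀ P : Ideal A, P.IsMaximal → ringKrullDim (B ⧸ P.map f) ≤ d) :
    ∃ U : Set (PrimeSpectrum A), IsOpen U ∧ U.Nonempty ∧
      ∀ P ∈ U, P.asIdeal.IsMaximal → d ≤ ringKrullDim (B ⧸ P.asIdeal.map f) := by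
  have : IsNoetherianRing A := Algebra.FiniteType.isNoetherianRing k A
  have : IsJacobsonRing A := isJacobsonRing_of_finiteType (A := k)
  let _ : Algebra k B := (f.comp (algebraMap k A)).toAlgebra
  have : Algebra.FiniteType k B :=
    RingHom.FiniteType.comp hf (RingHom.finiteType_algebraMap.mpr ‹_›)
  obtain ⟨Q, hQ⟩ := Ideal.exists_maximal B
  have hinj := f.injective_of_add_le_ringKrullDim k n d hA hB Q
    (hfib _ (Ideal.isMaximal_comap_of_finiteType f hf Q))
  obtain ⟨U, hU, hU', hUf⟩ := exists_isOpen_subset_range_comap f hf hinj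
  refine ⟨U, hU, hU', fun P hP hPmax ↦ ?_⟩
  obtain ⟨q, rfl⟩ := hUf hP
  obtain ⟨Q, hQ, hqQ⟩ := q.asIdeal.exists_le_maximal q.isPrime.ne_top
  let _ : Algebra A B := f.toAlgebra
  have : Q.LiesOver (comap f q).asIdeal :=
    ⟨hPmax.eq_of_le Ideal.IsPrime.ne_top' (Ideal.comap_mono hqQ)⟩
  have hle : _ ≤ _ + ringKrullDim (B ⧸ (comap f q).asIdeal.map f) :=
    ringKrullDim_le_add_ringKrullDim_fiber k Q (comap f q).asIdeal
  replace hle := hB.trans (hle.trans (add_le_add_left hA _))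
  rw [Nat.cast_add] at hle
  generalize ringKrullDim (B ⧸ (comap f q).asIdeal.map f) = c at hle ⊢
  induction c with
  | bot => simp at hle
  | coe c =>
    induction c with
    | top => exact le_top
    | coe c =>
      norm_cast at hle ⊢
      lia

theorem IsIrreducible.subset_of_le_topologicalKrullDim {T : Type*} [TopologicalSpace T]
    {F Z : Set T} (hF : IsIrreducible F) (hZ : IsClosed Z) {d : ℕ}
    (hFd : topologicalKrullDim F ≤ d) (hZd : d ≤ topologicalKrullDim ↥(Z ∩ F)) : F ⊆ Z := by
  by_contra hFZ
  have : IrreducibleSpace F := Subtype.irreducibleSpace hF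
  obtain ⟨l, hl⟩ := Order.le_krullDim_iff.mp hZd
  have hind : Topology.IsInducing (Set.inclusion (Set.inter_subset_right : Z ∩ F ⊆ F)) :=
    (Topology.IsEmbedding.inclusion _).isInducing
  let l' := l.map _ (TopologicalSpace.IrreducibleCloseds.map_strictMono_of_isInducing hind)
  let t : TopologicalSpace.IrreducibleCloseds F :=
    ⟨Set.univ, IrreducibleSpace.isIrreducible_univ F, isClosed_univ⟩
  have hlt : l'.last < t := by
    refine lt_of_le_of_ne (fun _ _ ↦ trivial) fun h ↦ hFZ fun x hx ↦ ?_
    have hxl : (⟨x, hx⟩ : F) ∈ l'.last := h ▸ trivial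
    have : closure (Set.inclusion (Set.inter_subset_right : Z ∩ F ⊆ F) '' l.last) ⊆
        Subtype.val ⁻¹' Z := by
      refine closure_minimal ?_ (hZ.preimage continuous_subtype_val)
      rintro _ ⟨y, -, rfl⟩
      exact y.2.1
    exact this hxl
  have := (Order.le_krullDim_iff (n := d + 1)).mpr ⟨l'.snoc t hlt, by simp [l', hl]⟩
  have := this.trans hFd
  norm_cast at this
  lia

theorem exists_forall_isOpenEmbedding_le_topologicalKrullDim {T : Type*} [TopologicalSpace T]
    {N : ℕ} (h : N ≤ topologicalKrullDim T) :
    ∃ x : T, ∀ {S : Type*} [TopologicalSpace S] (f : S → T),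
      Topology.IsOpenEmbedding f → x ∈ Set.range f → N ≤ topologicalKrullDim S := by
  obtain ⟨l, rfl⟩ := Order.le_krullDim_iff.mp h
  obtain ⟨x, hx⟩ := l.head.isIrreducible.nonempty
  refine ⟨x, fun {S} _ f hf ⟨y, hy⟩ ↦ ?_⟩
  let e := TopologicalSpace.IrreducibleCloseds.orderIsoOfIsOpenEmbedding f hf
  let C := e.symm ⟨l.head, y, by simpa [hy] using hx⟩
  have hC : Order.coheight C = Order.coheight l.head := by
    rw [← hf.coheight_map]
    exact congrArg Order.coheight (congrArg Subtype.val (e.apply_symm_apply _))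
  have := Order.coheight_le_krullDim C
  rw [hC] at this
  refine le_trans ?_ this
  exact WithBot.coe_le_coe.mpr Order.length_le_coheight_head

theorem Topology.exists_isClosed_singleton_mem {T : Type*} [TopologicalSpace T] [JacobsonSpace T]
    {U : Set T} (hU : IsOpen U) (hU' : U.Nonempty) : ∃ y ∈ U, IsClosed {y} := by
  obtain ⟨y, hy, hy'⟩ := nonempty_inter_closedPoints hU' hU.isLocallyClosed
  exact ⟨y, hy, hy'⟩

theorem Set.nonempty_of_le_topologicalKrullDim {T : Type*} [TopologicalSpace T] {s : Set T} {d : ℕ}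
    (h : d ≤ topologicalKrullDim s) : s.Nonempty := by
  by_contra! hs
  have : IsEmpty s := Set.isEmpty_coe_sort.mpr hs
  have : IsEmpty (TopologicalSpace.IrreducibleCloseds s) :=
    ⟨fun C ↦ isEmptyElim C.isIrreducible.nonempty.some⟩
  rw [topologicalKrullDim, Order.krullDim_eq_bot] at h
  exact absurd h (by simp)

theorem exists_isOpen_forall_le_topologicalKrullDim_fiber (k : Type*) {A R S T : Type*} [Field k]
    [CommRing A] [IsDomain A] [Algebra k A] [Algebra.FiniteType k A] [CommRing R]
    [TopologicalSpace S] [JacobsonSpace S] [TopologicalSpace T] (g : A →+* R) (hg : g.FiniteType)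
    (φ : T → S) {i : PrimeSpectrum A → S} {j : PrimeSpectrum R → T}
    (hi : Topology.IsOpenEmbedding i) (hj : Topology.IsOpenEmbedding j)
    (hcomm : ∀ x, φ (j x) = i (PrimeSpectrum.comap g x)) (n d : ℕ) (hA : ringKrullDim A ≤ n)
    (hφ : ∀ y : S, IsClosed {y} → topologicalKrullDim (φ ⁻¹' {y}) ≤ d) {Z : Set T}
    (hZ : IsPreirreducible Z) (hZc : IsClosed Z)
    (hdim : ((n + d : ℕ) : WithBot ℕ∞) ≤ topologicalKrullDim (j ⁻¹' Z)) :
    ∃ W : Set S, IsOpen W ∧ W.Nonempty ∧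
      ∀ y ∈ W, IsClosed {y} → d ≤ topologicalKrullDim ↥(Z ∩ φ ⁻¹' {y}) := by
  have hclosed : IsClosed (j ⁻¹' Z) := hZc.preimage hj.continuous
  have hne : (j ⁻¹' Z).Nonempty := Set.nonempty_of_le_topologicalKrullDim hdim
  let p := PrimeSpectrum.vanishingIdeal (j ⁻¹' Z)
  have hp : p.IsPrime :=
    PrimeSpectrum.isIrreducible_iff_vanishingIdeal_isPrime.mp ⟨hne, hZ.preimage hj⟩
  have hpZ : PrimeSpectrum.zeroLocus (p : Set R) = j ⁻¹' Z := by
    rw [PrimeSpectrum.zeroLocus_vanishingIdeal_eq_closure, hclosed.closure_eq]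
  let f : A →+* R ⧸ p := (Ideal.Quotient.mk p).comp g
  have hf : f.FiniteType := hg.comp_surjective Ideal.Quotient.mk_surjective
  have hemb : Topology.IsClosedEmbedding (PrimeSpectrum.comap (Ideal.Quotient.mk p)) :=
    PrimeSpectrum.isClosedEmbedding_comap_of_surjective _ _ Ideal.Quotient.mk_surjective
  have hrange : Set.range (PrimeSpectrum.comap (Ideal.Quotient.mk p)) = j ⁻¹' Z := by
    rw [range_comap_of_surjective _ _ Ideal.Quotient.mk_surjective,
      Ideal.mk_ker, hpZ]
  have hB : ((n + d : ℕ) : WithBot ℕ∞) ≤ ringKrullDim (R ⧸ p) := by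
    rw [← PrimeSpectrum.topologicalKrullDim_eq_ringKrullDim]
    refine hdim.trans ?_
    rw [← hrange]
    exact hemb.isEmbedding.toHomeomorph.symm.isInducing.topologicalKrullDim_le
  have hle (P : PrimeSpectrum A) (hP : P.asIdeal.IsMaximal) :
      ringKrullDim ((R ⧸ p) ⧸ P.asIdeal.map f) ≤ topologicalKrullDim ↥(Z ∩ φ ⁻¹' {i P}) := by
    rw [← PrimeSpectrum.topologicalKrullDim_eq_ringKrullDim]
    have hind := (hj.isInducing.comp hemb.isInducing).comp
      (PrimeSpectrum.isClosedEmbedding_comap_of_surjective _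
        (Ideal.Quotient.mk (P.asIdeal.map f)) Ideal.Quotient.mk_surjective).isInducing
    refine (hind.codRestrict (s := Z ∩ φ ⁻¹' {i P}) fun q ↦ ⟨?_, ?_⟩).topologicalKrullDim_le
    · exact hrange.subset ⟨_, rfl⟩
    · change φ (j _) = i P
      rw [hcomm]
      congr 1
      ext1
      refine (hP.eq_of_le Ideal.IsPrime.ne_top' ?_).symm
      change P.asIdeal ≤ Ideal.comap f (Ideal.comap _ q.asIdeal)
      rw [← Ideal.map_le_iff_le_comap, ← Ideal.map_le_iff_le_comap, Ideal.map_quotient_self]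
      exact bot_le
  have hcl (P : PrimeSpectrum A) : IsClosed {i P} ↔ P.asIdeal.IsMaximal := by
    rw [← PrimeSpectrum.isClosed_singleton_iff_isMaximal]
    exact Set.ext_iff.mp hi.preimage_closedPoints P
  obtain ⟨U, hU, hU', hUf⟩ := PrimeSpectrum.exists_isOpen_forall_le_ringKrullDim_fiber k f hf n d
    hA hB fun P hP ↦ (hle ⟨P, hP.isPrime⟩ hP).trans <|
      (Topology.IsEmbedding.inclusion Set.inter_subset_right).isInducing.topologicalKrullDim_le.trans
        (hφ _ ((hcl _).mpr hP))
  refine ⟨i '' U, hi.isOpenMap _ hU, hU'.image i, ?_⟩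
  rintro _ ⟨P, hPU, rfl⟩ hy
  have hP := (hcl P).mp hy
  exact (hUf P hPU hP).trans (hle P hP)

theorem exists_isOpen_forall_le_topologicalKrullDim_inter_preimage {k : Type} [Field k]
    {X Y : Scheme} [IsIntegral Y] [JacobsonSpace Y] (φ : X ⟶ Y) [LocallyOfFiniteType φ]
    (sY : Y ⟶ Spec (CommRingCat.of k)) [LocallyOfFiniteType sY] (d n : ℕ)
    (hY : topologicalKrullDim Y ≤ n)
    (hφ : ∀ y : Y, IsClosed {y} → topologicalKrullDim (φ ⁻¹' {y}) ≤ d) {Z : Set X}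
    (hZ : IsPreirreducible Z) (hZc : IsClosed Z)
    (hdim : ((n + d : ℕ) : WithBot ℕ∞) ≤ topologicalKrullDim Z) :
    ∃ W : Set Y, IsOpen W ∧ W.Nonempty ∧
      ∀ y ∈ W, IsClosed {y} → d ≤ topologicalKrullDim ↥(Z ∩ φ ⁻¹' {y}) := by
  obtain ⟨x, hx⟩ := exists_forall_isOpenEmbedding_le_topologicalKrullDim hdim
  obtain ⟨V, hV, hxV, -⟩ := exists_isAffineOpen_mem_and_subset (U := ⊤) (x := φ x) (by simp)
  obtain ⟨U, hU, hxU, hUV⟩ := exists_isAffineOpen_mem_and_subset (U := φ ⁻¹ᵁ V) (x := x) hxV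
  have : Nonempty V := ⟨⟨_, hxV⟩⟩
  let fk : k →+* Γ(Y, V) :=
    (sY.appLE ⊤ V le_top).hom.comp (Scheme.ΓSpecIso (CommRingCat.of k)).inv.hom
  have hfk : fk.FiniteType :=
    (sY.finiteType_appLE (isAffineOpen_top _) hV le_top).comp <| RingHom.FiniteType.of_surjective _
      (ConcreteCategory.bijective_of_isIso (Scheme.ΓSpecIso (CommRingCat.of k)).inv).2
  let _ : Algebra k Γ(Y, V) := fk.toAlgebra
  have : Algebra.FiniteType k Γ(Y, V) := hfk
  have hi := hV.fromSpec.isOpenEmbedding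
  have hj := hU.fromSpec.isOpenEmbedding
  refine exists_isOpen_forall_le_topologicalKrullDim_fiber k (φ.appLE V U hUV).hom
    (φ.finiteType_appLE hV hU hUV) φ hi hj (fun q ↦ ?_) n d ?_ hφ hZ hZc ?_
  · have := congrArg (fun h ↦ h.base q) (hV.SpecMap_appLE_fromSpec φ hU hUV)
    exact this.symm
  · rw [← PrimeSpectrum.topologicalKrullDim_eq_ringKrullDim]
    exact hi.isInducing.topologicalKrullDim_le.trans hY
  · refine hx _ (hj.restrictPreimage Z) ?_
    obtain ⟨q, hq⟩ := hU.range_fromSpec.ge hxU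
    exact ⟨⟨q, Set.mem_preimage.mpr (hq.symm ▸ x.2)⟩, Subtype.ext hq⟩

/-- **Lemma.** Let `φ : X → Y` be a morphism of algebraic varieties over an algebraically
closed field `k` of characteristic zero (varieties being modeled as reduced separated
schemes of finite type over `k`), and let `d, n` be positive integers such that:
(a) `Y` is irreducible and `dim Y = n`;
(b) `dim φ⁻¹(y) = d` for every (closed) point `y ∈ Y`;
(c) `φ⁻¹(y)` is irreducible for every (closed) point `y` of a dense open subset of `Y`;
(d) every irreducible component of `X` has dimension at least `n + d`.
Then `X` is irreducible. -/
theorem irreducible_of_fibers {k : Type} [Field k] [IsAlgClosed k] [CharZero k]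
    (X Y : Scheme) (sX : X ⟶ Spec (CommRingCat.of k)) (sY : Y ⟶ Spec (CommRingCat.of k))
    [IsReduced X] [IsReduced Y]
    [LocallyOfFiniteType sX] [LocallyOfFiniteType sY]
    [QuasiCompact sX] [QuasiCompact sY]
    [AlgebraicGeometry.IsSeparated sX] [AlgebraicGeometry.IsSeparated sY]
    (φ : X ⟶ Y) (hφ : φ ≫ sY = sX)
    (d n : ℕ) (hd : 0 < d) (hn : 0 < n)
    (ha : IrreducibleSpace Y) (ha' : topologicalKrullDim Y = (n : ℕ∞))
    (hb : ∀ y : Y, IsClosed ({y} : Set Y) →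
      topologicalKrullDim (φ.base ⁻¹' {y}) = (d : ℕ∞))
    (hc : ∃ O : Set Y, IsOpen O ∧ Dense O ∧
      ∀ y ∈ O, IsClosed ({y} : Set Y) → IsIrreducible (φ.base ⁻¹' {y}))
    (hdim : ∀ Z ∈ irreducibleComponents X, ((n + d : ℕ) : ℕ∞) ≤ topologicalKrullDim Z) :
    IrreducibleSpace X := by
  subst hφ
  have : LocallyOfFiniteType φ := locallyOfFiniteType_of_comp φ sY
  have : JacobsonSpace Y := LocallyOfFiniteType.jacobsonSpace sY
  have : JacobsonSpace X := LocallyOfFiniteType.jacobsonSpace φ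
  have : IsIntegral Y := isIntegral_of_irreducibleSpace_of_isReduced Y
  obtain ⟨O, hO, hOd, hOirr⟩ := hc
  have hW (Z : Set X) (hZ : Z ∈ irreducibleComponents X) :=
    exists_isOpen_forall_le_topologicalKrullDim_inter_preimage φ sY d n ha'.le
      (fun y hy ↦ (hb y hy).le) hZ.1.isPreirreducible
      (isClosed_of_mem_irreducibleComponents Z hZ) (hdim Z hZ)
  have hsub (Z : Set X) (hZ : Z ∈ irreducibleComponents X) :
      ∃ W : Set Y, IsOpen W ∧ W.Nonempty ∧ φ ⁻¹' W ⊆ Z := by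
    obtain ⟨W, hWo, hWne, hWd⟩ := hW Z hZ
    have hZc := isClosed_of_mem_irreducibleComponents Z hZ
    refine ⟨O ∩ W, hO.inter hWo, hOd.inter_open_nonempty W hWo hWne |>.mono (by simp), ?_⟩
    have hopen : IsOpen (φ ⁻¹' (O ∩ W)) := (hO.inter hWo).preimage φ.continuous
    refine subset_closure.trans ?_
    rw [← JacobsonSpace.closure_inter_closedPoints_eq_closure hopen.isLocallyClosed]
    refine closure_minimal (fun x ⟨hxW, hx⟩ ↦ ?_) hZc
    have hy : IsClosed {φ x} := φ.closePoints_subset_preimage_closedPoints hx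
    exact (hOirr _ hxW.1 hy).subset_of_le_topologicalKrullDim hZc (hb _ hy).le
      (hWd _ hxW.2 hy) rfl
  have hle (Z Z' : Set X) (hZ : Z ∈ irreducibleComponents X) (hZ' : Z' ∈ irreducibleComponents X) :
      Z' ⊆ Z := by
    obtain ⟨W, hWo, hWne, hWZ⟩ := hsub Z hZ
    obtain ⟨W', hWo', hWne', hWd⟩ := hW Z' hZ'
    obtain ⟨y, hy, hyc⟩ := Topology.exists_isClosed_singleton_mem (hWo.inter hWo')
      (nonempty_preirreducible_inter hWo hWo' hWne hWne')
    obtain ⟨x, hxZ, hxy⟩ := Set.nonempty_of_le_topologicalKrullDim (hWd y hy.2 hyc)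
    have hxW : x ∈ φ ⁻¹' W := by
      change φ x ∈ W
      rw [show φ x = y from hxy]
      exact hy.1
    refine (subset_closure_inter_of_isPreirreducible_of_isOpen hZ'.1.isPreirreducible
      (hWo.preimage φ.continuous) ⟨x, hxZ, hxW⟩).trans ?_
    exact closure_minimal (Set.inter_subset_right.trans hWZ)
      (isClosed_of_mem_irreducibleComponents Z hZ)
  obtain ⟨y, -, hy⟩ :=
    Topology.exists_isClosed_singleton_mem (isOpen_univ (X := Y)) Set.univ_nonempty
  obtain ⟨x, -⟩ := Set.nonempty_of_le_topologicalKrullDim (hb y hy).ge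
  have hx := irreducibleComponent_mem_irreducibleComponents x
  have huniv : irreducibleComponent x = Set.univ := Set.eq_univ_of_forall fun x' ↦
    hle _ _ hx (irreducibleComponent_mem_irreducibleComponents x') mem_irreducibleComponent
  have : PreirreducibleSpace X := ⟨huniv ▸ hx.1.isPreirreducible⟩
  exact ⟨⟨x⟩⟩
end
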